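/- arXiv:2009.02125 — 2 statements merged into one kernel-verified Lean document; each statement's English description precedes it below -/
import Mathlib

section
/- For a permutation w in S_n with length ℓ(w) = ℓ, the following are equivalent: (a) w contains the pattern 3412 exactly once and avoids the pattern 321; (b) the Bruhat interval [e,w] is isomorphic as a poset to the product [e,3412] × B_{ℓ−4}, where [e,3412] is the Bruhat interval below the permutation 3412 in S_4 and B_{ℓ−4} is the Boolean lattice of rank ℓ−4. -/
/-- `simpleT n i` is the adjacent transposition `sᵢ = (i, i+1)` (one-indexed values),
acting on `{1, …, n}` represented (zero-indexed) by `Fin n`.  It is the identity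
permutation when `i` is outside the valid range `1 ≤ i ≤ n - 1`. -/
def simpleT (n : ℕ) (i : ℕ) : Equiv.Perm (Fin n) :=
  if h : 1 ≤ i ∧ i < n then Equiv.swap ⟨i - 1, by omega⟩ ⟨i, h.2⟩ else 1

/-- The (Coxeter) length `ℓ(w)`: the minimal number of adjacent transpositions whose
product is `w`. -/
noncomputable def permLen (n : ℕ) (w : Equiv.Perm (Fin n)) : ℕ :=
  sInf {l : ℕ | ∃ word : List ℕ, word.length = l ∧ (word.map (simpleT n)).prod = w}

/-- `word` is a reduced decomposition of `w`: its product is `w` and its length is `ℓ(w)`. -/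
def IsReducedWord (n : ℕ) (word : List ℕ) (w : Equiv.Perm (Fin n)) : Prop :=
  (word.map (simpleT n)).prod = w ∧ word.length = permLen n w

/-- The support of `w`: the set of letters `i` such that `sᵢ` appears in some reduced
decomposition of `w`. -/
def permSupp (n : ℕ) (w : Equiv.Perm (Fin n)) : Set ℕ :=
  {i | ∃ word : List ℕ, IsReducedWord n word w ∧ i ∈ word}

/-- Bruhat order: `v ≤ w` iff some reduced decomposition of `v` is a subword of some
reduced decomposition of `w`. -/
def bruhatLE (n : ℕ) (v w : Equiv.Perm (Fin n)) : Prop :=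
  ∃ wordv wordw : List ℕ, IsReducedWord n wordv v ∧ IsReducedWord n wordw w ∧
    wordv.Sublist wordw

/-- Strict Bruhat order. -/
def bruhatLT (n : ℕ) (v w : Equiv.Perm (Fin n)) : Prop :=
  bruhatLE n v w ∧ v ≠ w

/-- An occurrence of the pattern `p ∈ S_k` in `w ∈ S_n`: a strictly increasing sequence
`j` of indices such that the entries of `w` along `j` are in the same relative order
as the entries of `p`. -/
def IsPatternOcc {n k : ℕ} (w : Equiv.Perm (Fin n)) (p : Equiv.Perm (Fin k))
    (j : Fin k → Fin n) : Prop :=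
  StrictMono j ∧ ∀ a b : Fin k, w (j a) < w (j b) ↔ p a < p b

/-- `w` contains the pattern `p`. -/
def ContainsPattern {n k : ℕ} (w : Equiv.Perm (Fin n)) (p : Equiv.Perm (Fin k)) : Prop :=
  ∃ j : Fin k → Fin n, IsPatternOcc w p j

/-- `w` avoids the pattern `p`. -/
def AvoidsPattern {n k : ℕ} (w : Equiv.Perm (Fin n)) (p : Equiv.Perm (Fin k)) : Prop :=
  ¬ ContainsPattern w p

/-- `w` contains the pattern `p` exactly once. -/
def ContainsPatternOnce {n k : ℕ} (w : Equiv.Perm (Fin n)) (p : Equiv.Perm (Fin k)) : Prop :=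
  ∃! j : Fin k → Fin n, IsPatternOcc w p j

/-- The number of occurrences of the pattern `p` in `w`. -/
noncomputable def numOcc {n k : ℕ} (w : Equiv.Perm (Fin n)) (p : Equiv.Perm (Fin k)) : ℕ :=
  Set.ncard {j : Fin k → Fin n | IsPatternOcc w p j}

/-- The pattern `321` (one-line notation `1↦3, 2↦2, 3↦1`), as a permutation of `Fin 3`. -/
def pattern321 : Equiv.Perm (Fin 3) := Equiv.swap 0 2

/-- The pattern `3412` (one-line notation `1↦3, 2↦4, 3↦1, 4↦2`). -/
def pattern3412 : Equiv.Perm (Fin 4) := Equiv.swap 0 2 * Equiv.swap 1 3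

/-- The pattern `4231` (one-line notation `1↦4, 2↦2, 3↦3, 4↦1`). -/
def pattern4231 : Equiv.Perm (Fin 4) := Equiv.swap 0 3

/-- The pattern `4321` (one-line notation `1↦4, 2↦3, 3↦2, 4↦1`). -/
def pattern4321 : Equiv.Perm (Fin 4) := Equiv.swap 0 3 * Equiv.swap 1 2

/-- The point `(u(1), …, u(n)) ∈ ℝⁿ` attached to a permutation `u` (one-indexed values). -/
def permPoint (n : ℕ) (u : Equiv.Perm (Fin n)) : Fin n → ℝ :=
  fun k => ((u k : ℕ) : ℝ) + 1

/-- The Bruhat interval polytope `Q_{v,w}`: the convex hull of the points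
`(u(1), …, u(n))` for all `u` with `v ≤ u ≤ w` in Bruhat order. -/
noncomputable def BIP (n : ℕ) (v w : Equiv.Perm (Fin n)) : Set (Fin n → ℝ) :=
  convexHull ℝ
    {x | ∃ u : Equiv.Perm (Fin n), bruhatLE n v u ∧ bruhatLE n u w ∧ x = permPoint n u}

/-- A face of a polytope `P`: a convex extreme subset of `P`. -/
def IsFaceOf {E : Type*} [AddCommGroup E] [Module ℝ E] (P F : Set E) : Prop :=
  IsExtreme ℝ P F ∧ Convex ℝ F

/-- Combinatorial equivalence of two polytopes: an inclusion-preserving (in both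
directions) bijection between their face lattices. -/
def CombEquiv {E F : Type*} [AddCommGroup E] [Module ℝ E] [AddCommGroup F] [Module ℝ F]
    (P : Set E) (Q : Set F) : Prop :=
  ∃ e : {A : Set E // IsFaceOf P A} ≃ {B : Set F // IsFaceOf Q B},
    ∀ A B : {A : Set E // IsFaceOf P A}, A.1 ⊆ B.1 ↔ (e A).1 ⊆ (e B).1

/-- The transposition `(i, j)` (one-indexed values, `1 ≤ i < j ≤ n`), acting on
`{1, …, n}` represented by `Fin n`; identity for invalid input. -/
def transpPerm (n i j : ℕ) : Equiv.Perm (Fin n) :=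
  if h : 1 ≤ i ∧ i < j ∧ j ≤ n then Equiv.swap ⟨i - 1, by omega⟩ ⟨j - 1, by omega⟩ else 1

/-- `T̄(u,[v,w])`: the set of transpositions `(i,j)`, `i < j`, with
`u < u·(i,j) ≤ w` and `ℓ(u·(i,j)) = ℓ(u) + 1`. -/
def upperT (n : ℕ) (u v w : Equiv.Perm (Fin n)) : Set (ℕ × ℕ) :=
  {p | 1 ≤ p.1 ∧ p.1 < p.2 ∧ p.2 ≤ n ∧
    bruhatLT n u (u * transpPerm n p.1 p.2) ∧ bruhatLE n (u * transpPerm n p.1 p.2) w ∧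
    permLen n (u * transpPerm n p.1 p.2) = permLen n u + 1}

/-- `T̲(u,[v,w])`: the set of transpositions `(i,j)`, `i < j`, with
`v ≤ u·(i,j) < u` and `ℓ(u·(i,j)) = ℓ(u) - 1`. -/
def lowerT (n : ℕ) (u v w : Equiv.Perm (Fin n)) : Set (ℕ × ℕ) :=
  {p | 1 ≤ p.1 ∧ p.1 < p.2 ∧ p.2 ≤ n ∧
    bruhatLE n v (u * transpPerm n p.1 p.2) ∧ bruhatLT n (u * transpPerm n p.1 p.2) u ∧
    permLen n (u * transpPerm n p.1 p.2) + 1 = permLen n u}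

/-- The permutohedron `Perm₂ ⊂ ℝ³`, a hexagon. -/
noncomputable def Perm2Hex : Set (Fin 3 → ℝ) :=
  convexHull ℝ {x | ∃ σ : Equiv.Perm (Fin 3), x = permPoint 3 σ}

/-- The action of `s_r` on one-indexed letters: swaps `r` and `r + 1`. -/
def srNat (r x : ℕ) : ℕ := if x = r then r + 1 else if x = r + 1 then r else x



open Equiv

def WP (n : ℕ) (a : List ℕ) : Equiv.Perm (Fin n) := (a.map (simpleT n)).prod

lemma WP_nil (n : ℕ) : WP n [] = 1 := by simp [WP]
lemma WP_cons (n : ℕ) (j : ℕ) (a : List ℕ) : WP n (j :: a) = simpleT n j * WP n a := by simp [WP]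
lemma WP_append (n : ℕ) (a b : List ℕ) : WP n (a ++ b) = WP n a * WP n b := by simp [WP]

lemma simpleT_val (n i : ℕ) (h : 1 ≤ i ∧ i < n) (k : Fin n) :
    ((simpleT n i k : Fin n) : ℕ) =
      if k.val + 1 = i then i else if k.val = i then i - 1 else k.val := by
  unfold simpleT
  rw [dif_pos h, Equiv.swap_apply_def]
  simp only [Fin.ext_iff]
  split_ifs <;> (try dsimp only) <;> omega

lemma simpleT_invalid (n i : ℕ) (h : ¬ (1 ≤ i ∧ i < n)) : simpleT n i = 1 := by
  unfold simpleT
  rw [dif_neg h]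

lemma simpleT_mul_self (n i : ℕ) : simpleT n i * simpleT n i = 1 := by
  unfold simpleT
  split_ifs <;> simp

lemma simpleT_mul_self_assoc (n i : ℕ) (x : Equiv.Perm (Fin n)) :
    simpleT n i * (simpleT n i * x) = x := by
  rw [← mul_assoc, simpleT_mul_self, one_mul]

lemma simpleT_inv (n i : ℕ) : (simpleT n i)⁻¹ = simpleT n i :=
  inv_eq_of_mul_eq_one_left (simpleT_mul_self n i)

lemma simpleT_app_app (n i : ℕ) (x : Fin n) : simpleT n i (simpleT n i x) = x := by
  have := congrArg (fun f : Equiv.Perm (Fin n) => f x) (simpleT_mul_self n i)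
  simpa using this

lemma simple_mul_inv_apply (n i : ℕ) (w : Equiv.Perm (Fin n)) (x : Fin n) :
    (simpleT n i * w)⁻¹ x = w⁻¹ (simpleT n i x) := by
  rw [mul_inv_rev, simpleT_inv]; rfl

lemma simple_flip (n i : ℕ) (x y : Fin n) (hxy : x < y)
    (h : ¬ simpleT n i x < simpleT n i y) :
    (1 ≤ i ∧ i < n) ∧ x.val + 1 = i ∧ y.val = i ∧ simpleT n i = swap x y := by
  by_cases hv : 1 ≤ i ∧ i < n
  · rw [Fin.lt_def, simpleT_val n i hv, simpleT_val n i hv] at h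
    rw [Fin.lt_def] at hxy
    have : x.val + 1 = i ∧ y.val = i := by
      split_ifs at h <;> omega
    refine ⟨hv, this.1, this.2, ?_⟩
    unfold simpleT
    rw [dif_pos hv]
    congr 1 <;> apply Fin.ext <;> simp <;> omega
  · rw [simpleT_invalid n i hv] at h
    exact absurd hxy h

lemma exchange (n : ℕ) (a : List ℕ) : ∀ x y : Fin n, x < y → (WP n a)⁻¹ y < (WP n a)⁻¹ x →
    ∃ p j q, a = p ++ j :: q ∧ swap x y * WP n a = WP n (p ++ q) := by
  induction a with
  | nil => intro x y hxy h; simp [WP_nil] at h; exact absurd h (not_lt.mpr hxy.le)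
  | cons j a ih =>
    intro x y hxy h
    rw [WP_cons, simple_mul_inv_apply, simple_mul_inv_apply] at h
    by_cases hs : simpleT n j x < simpleT n j y
    · obtain ⟨p, k, q, rfl, e⟩ := ih _ _ hs h
      refine ⟨j :: p, k, q, rfl, ?_⟩
      rw [WP_cons, List.cons_append, WP_cons, ← e, ← mul_assoc, ← mul_assoc,
        Equiv.mul_swap_eq_swap_mul, simpleT_app_app, simpleT_app_app]
    · obtain ⟨-, -, -, e⟩ := simple_flip n j x y hxy hs
      refine ⟨[], j, a, rfl, ?_⟩
      rw [WP_cons, ← e, simpleT_mul_self_assoc]; rfl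

def InSub (n : ℕ) (x : Equiv.Perm (Fin n)) (a : List ℕ) : Prop := ∃ b, b.Sublist a ∧ WP n b = x

lemma permLen_le (n : ℕ) (a : List ℕ) : permLen n (WP n a) ≤ a.length :=
  Nat.sInf_le ⟨a, rfl, rfl⟩

lemma exists_word (n : ℕ) (w : Equiv.Perm (Fin n)) : ∃ a, WP n a = w := by
  rcases n with _ | n
  · exact ⟨[], Subsingleton.elim _ _⟩
  have h : w ∈ Submonoid.closure (Set.range fun i : Fin n => swap i.castSucc i.succ) := by
    rw [Equiv.Perm.mclosure_swap_castSucc_succ]; trivial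
  induction h using Submonoid.closure_induction with
  | mem x hx =>
    obtain ⟨i, rfl⟩ := hx
    refine ⟨[i.val + 1], ?_⟩
    have hi := i.isLt
    simp only [WP_cons, WP_nil, mul_one]
    unfold simpleT
    rw [dif_pos ⟨by omega, by omega⟩]
    rfl
  | one => exact ⟨[], rfl⟩
  | mul x y _ _ hx hy =>
    obtain ⟨a, rfl⟩ := hx
    obtain ⟨b, rfl⟩ := hy
    exact ⟨a ++ b, WP_append _ _ _⟩

lemma exists_reduced (n : ℕ) (w : Equiv.Perm (Fin n)) : ∃ a, IsReducedWord n a w := by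
  have := Nat.sInf_mem (s := {l : ℕ | ∃ word : List ℕ, word.length = l ∧
    (word.map (simpleT n)).prod = w}) (by
      obtain ⟨a, ha⟩ := exists_word n w
      exact ⟨a.length, a, rfl, ha⟩)
  obtain ⟨a, h1, h2⟩ := this
  exact ⟨a, h2, h1⟩

/-- reducedness of a word -/
def Red (n : ℕ) (a : List ℕ) : Prop := a.length = permLen n (WP n a)

lemma isReducedWord_iff (n : ℕ) (a : List ℕ) (w : Equiv.Perm (Fin n)) :
    IsReducedWord n a w ↔ WP n a = w ∧ Red n a := by
  constructor
  · rintro ⟨rfl, h⟩; exact ⟨rfl, h⟩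
  · rintro ⟨rfl, h⟩; exact ⟨rfl, h⟩

lemma Red.le {n : ℕ} {a b : List ℕ} (h : Red n a) (e : WP n b = WP n a) : a.length ≤ b.length := by
  rw [h, ← e]; exact permLen_le n b

lemma Red.tail {n j : ℕ} {a : List ℕ} (h : Red n (j :: a)) : Red n a := by
  obtain ⟨b, hb, hb'⟩ := exists_reduced n (WP n a)
  have : (j :: a).length ≤ (j :: b).length := h.le (by rw [WP_cons, WP_cons]; congr 1)
  have h2 := permLen_le n a
  simp at this
  unfold Red
  omega

lemma Red.valid {n j : ℕ} {a : List ℕ} (h : Red n (j :: a)) : 1 ≤ j ∧ j < n := by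
  by_contra hv
  have := h.le (b := a) (by rw [WP_cons, simpleT_invalid n j hv, one_mul])
  simp at this

lemma Red.valid_mem {n : ℕ} {a : List ℕ} (h : Red n a) : ∀ j ∈ a, 1 ≤ j ∧ j < n := by
  induction a with
  | nil => simp
  | cons k a ih =>
    intro j hj
    rcases List.mem_cons.mp hj with rfl | hj
    · exact h.valid
    · exact ih h.tail j hj

lemma swap_eq_simple (n : ℕ) (x y : Fin n) (h : x.val + 1 = y.val) :
    swap x y = simpleT n y.val := by
  unfold simpleT
  rw [dif_pos ⟨by omega, y.isLt⟩]
  congr 1; apply Fin.ext; simp; omega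

/-- leading letter of a reduced word is an ascent of the rest -/
lemma Red.ascent {n : ℕ} {a : List ℕ} {y : Fin n} (h : Red n (y.val :: a)) (x : Fin n)
    (hx : x.val + 1 = y.val) : (WP n a)⁻¹ x < (WP n a)⁻¹ y := by
  rcases lt_trichotomy ((WP n a)⁻¹ x) ((WP n a)⁻¹ y) with h1 | h1 | h1
  · exact h1
  · have := (WP n a)⁻¹.injective h1; subst this; omega
  · exfalso
    obtain ⟨p, j, q, rfl, e⟩ := exchange n a x y (by rw [Fin.lt_def]; omega) h1
    have := h.le (b := p ++ q) (by rw [← e, swap_eq_simple n x y hx, WP_cons])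
    simp at this

lemma red_of_ascent {n : ℕ} {a : List ℕ} (h : Red n a) (x y : Fin n) (hx : x.val + 1 = y.val)
    (hl : (WP n a)⁻¹ x < (WP n a)⁻¹ y) : Red n (y.val :: a) := by
  obtain ⟨b, hb, hb'⟩ := exists_reduced n (WP n (y.val :: a))
  change WP n b = _ at hb
  have hs := swap_eq_simple n x y hx
  have hxy : x < y := by rw [Fin.lt_def]; omega
  obtain ⟨p, j, q, rfl, e⟩ := exchange n b x y hxy (by
    rw [hb, WP_cons, ← hs, mul_inv_rev]; simp; exact hl)
  have h1 := h.le (b := p ++ q) (by rw [← e, hb, hs, WP_cons, simpleT_mul_self_assoc])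
  have := permLen_le n (y.val :: a)
  unfold Red
  simp at *
  omega

lemma deletion (n : ℕ) : ∀ (m : ℕ) (a : List ℕ), a.length ≤ m →
    ∃ b, b.Sublist a ∧ WP n b = WP n a ∧ Red n b := by
  intro m
  induction m with
  | zero => 
    intro a ha
    have : a = [] := List.length_eq_zero_iff.mp (by omega)
    subst this
    refine ⟨[], List.Sublist.refl _, rfl, ?_⟩
    have := permLen_le n []
    unfold Red
    simp at *
    omega
  | succ m ih =>
    intro a ha
    rcases a with _ | ⟨j, a⟩
    · exact ih [] (by simp)
    simp at ha
    obtain ⟨b, hb, e, hr⟩ := ih a ha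
    by_cases hv : 1 ≤ j ∧ j < n
    · let x : Fin n := ⟨j - 1, by omega⟩
      let y : Fin n := ⟨j, hv.2⟩
      have hx : x.val + 1 = y.val := by simp [x, y]; omega
      rcases lt_trichotomy ((WP n b)⁻¹ x) ((WP n b)⁻¹ y) with h1 | h1 | h1
      · exact ⟨j :: b, hb.cons_cons j, by rw [WP_cons, WP_cons, e], red_of_ascent hr x y hx h1⟩
      · have := (WP n b)⁻¹.injective h1
        rw [← this] at hx; omega
      · obtain ⟨p, k, q, rfl, e'⟩ := exchange n b x y (by rw [Fin.lt_def]; omega) h1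
        have hl := hb.length_le
        simp at hl
        obtain ⟨c, hc, e2, hr2⟩ := ih (p ++ q) (by simp; omega)
        refine ⟨c, ?_, ?_, hr2⟩
        · refine hc.trans (List.Sublist.trans ?_ (hb.trans (List.sublist_cons_self _ _)))
          exact List.Sublist.append_left (List.sublist_cons_self _ _) _
        · rw [e2, ← e', swap_eq_simple n x y hx, WP_cons, e]
    · exact ⟨b, hb.trans (List.sublist_cons_self _ _),
        by rw [WP_cons, simpleT_invalid n j hv, one_mul, e], hr⟩

lemma deletion' (n : ℕ) (a : List ℕ) : ∃ b, b.Sublist a ∧ WP n b = WP n a ∧ Red n b :=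
  deletion n _ a le_rfl

/-- Bruhat edges -/
def BR (n : ℕ) (x y : Equiv.Perm (Fin n)) : Prop :=
  ∃ p q : Fin n, p < q ∧ x⁻¹ p < x⁻¹ q ∧ y = swap p q * x

lemma BR_lift (n i : ℕ) (x z : Equiv.Perm (Fin n)) (h : BR n x z) :
    z = simpleT n i * x ∨ BR n (simpleT n i * x) (simpleT n i * z) := by
  obtain ⟨p, q, hpq, hx, rfl⟩ := h
  by_cases hs : simpleT n i p < simpleT n i q
  · right
    refine ⟨_, _, hs, ?_, ?_⟩
    · simpa [simple_mul_inv_apply, simpleT_app_app] using hx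
    · rw [← mul_assoc, ← mul_assoc, Equiv.mul_swap_eq_swap_mul]
  · left
    rw [(simple_flip n i p q hpq hs).2.2.2]

lemma BR_chain_lift (n i : ℕ) (x y : Equiv.Perm (Fin n)) (h : Relation.ReflTransGen (BR n) x y)
    (hy : BR n y (simpleT n i * y)) :
    Relation.ReflTransGen (BR n) (simpleT n i * x) (simpleT n i * y) := by
  induction h using Relation.ReflTransGen.head_induction_on with
  | refl => exact .refl
  | head h1 h2 ih =>
    rcases BR_lift n i _ _ h1 with e | e
    · rw [← e]; exact h2.tail hy
    · exact ih.head e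

lemma chain_of_sub (n : ℕ) (a : List ℕ) (hr : Red n a) : ∀ x, InSub n x a →
    Relation.ReflTransGen (BR n) x (WP n a) := by
  induction a with
  | nil => rintro x ⟨b, hb, rfl⟩; rw [List.sublist_nil.mp hb]
  | cons j a ih =>
    rintro x ⟨b, hb, rfl⟩
    have hv := hr.valid
    have hy : BR n (WP n a) (simpleT n j * WP n a) := by
      let x : Fin n := ⟨j - 1, by omega⟩
      let y : Fin n := ⟨j, hv.2⟩
      have hx : x.val + 1 = y.val := by simp [x, y]; omega
      refine ⟨x, y, by rw [Fin.lt_def]; omega, Red.ascent (y := y) hr x hx, ?_⟩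
      rw [swap_eq_simple n x y hx]
    rw [WP_cons]
    rcases List.sublist_cons_iff.mp hb with h | ⟨c, rfl, h⟩
    · exact (ih hr.tail _ ⟨b, h, rfl⟩).tail hy
    · rw [WP_cons]
      exact BR_chain_lift n j _ _ (ih hr.tail _ ⟨c, h, rfl⟩) hy

lemma sub_of_chain (n : ℕ) (x y : Equiv.Perm (Fin n)) (h : Relation.ReflTransGen (BR n) x y) :
    ∀ a, WP n a = y → InSub n x a := by
  induction h with
  | refl => intro a ha; exact ⟨a, List.Sublist.refl _, ha⟩
  | tail h1 h2 ih =>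
    rintro a ha
    obtain ⟨p, q, hpq, hx, rfl⟩ := h2
    obtain ⟨l, j, r, rfl, e⟩ := exchange n a p q hpq (by rw [ha, mul_inv_rev]; simp; exact hx)
    obtain ⟨b, hb, e2⟩ := ih (l ++ r) (by rw [← e, ha, ← mul_assoc, Equiv.swap_mul_self, one_mul])
    exact ⟨b, hb.trans (List.Sublist.append_left (List.sublist_cons_self _ _) _), e2⟩

theorem bruhat_iff (n : ℕ) (x : Equiv.Perm (Fin n)) (a : List ℕ) (hr : Red n a) :
    bruhatLE n x (WP n a) ↔ InSub n x a := by
  constructor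
  · rintro ⟨c, b, hc, hb, hs⟩
    rw [isReducedWord_iff] at hc hb
    refine sub_of_chain n _ _ ?_ a rfl
    rw [← hb.1]
    exact chain_of_sub n b hb.2 x ⟨c, hs, hc.1⟩
  · rintro ⟨b, hb, rfl⟩
    obtain ⟨c, hc, e, hr'⟩ := deletion' n b
    exact ⟨c, a, (isReducedWord_iff _ _ _).2 ⟨e, hr'⟩, (isReducedWord_iff _ _ _).2 ⟨rfl, hr⟩,
      hc.trans hb⟩


lemma perm_app_inv {n : ℕ} (x : Equiv.Perm (Fin n)) (p : Fin n) : x (x⁻¹ p) = p :=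
  Equiv.apply_symm_apply x p

def rr (n j : ℕ) (x : Equiv.Perm (Fin n)) : ℕ :=
  (Finset.univ.filter fun k : Fin n => k.val < j ∧ j ≤ (x k).val).card

lemma rr_dual (n j : ℕ) (x : Equiv.Perm (Fin n)) :
    rr n j x = (Finset.univ.filter fun k : Fin n => j ≤ k.val ∧ (x k).val < j).card := by
  have h1 : (Finset.univ.filter fun k : Fin n => k.val < j).card =
      (Finset.univ.filter fun k : Fin n => (x k).val < j).card := by
    symm
    apply Finset.card_bij (fun k _ => x k)
    · simp
    · intro a _ b _ h; exact x.injective h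
    · intro b hb; exact ⟨x.symm b, by simpa using hb, by simp⟩
  have h2 := Finset.card_filter_add_card_filter_not
    (s := Finset.univ.filter fun k : Fin n => k.val < j) (fun k => (x k).val < j)
  have h3 := Finset.card_filter_add_card_filter_not
    (s := Finset.univ.filter fun k : Fin n => (x k).val < j) (fun k => k.val < j)
  rw [Finset.filter_filter, Finset.filter_filter] at h2 h3
  unfold rr
  have e1 : (Finset.univ.filter fun k : Fin n => k.val < j ∧ (x k).val < j) =
    (Finset.univ.filter fun k : Fin n => (x k).val < j ∧ k.val < j) := by
    ext k; simp; tauto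
  have e2 : (Finset.univ.filter fun k : Fin n => k.val < j ∧ j ≤ (x k).val) =
    (Finset.univ.filter fun k : Fin n => k.val < j ∧ ¬ (x k).val < j) := by
    ext k; simp
  have e3 : (Finset.univ.filter fun k : Fin n => j ≤ k.val ∧ (x k).val < j) =
    (Finset.univ.filter fun k : Fin n => (x k).val < j ∧ ¬ k.val < j) := by
    ext k; simp; tauto
  rw [e2, e3]
  rw [e1] at h2
  omega

lemma rr_inv (n j : ℕ) (x : Equiv.Perm (Fin n)) : rr n j x⁻¹ = rr n j x := by
  rw [rr_dual]
  unfold rr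
  apply Finset.card_bij (fun k _ => x⁻¹ k)
  · intro k hk; simp at *; exact ⟨hk.2, hk.1⟩
  · intro a _ b _ h; exact x⁻¹.injective h
  · intro b hb; exact ⟨x b, by simp at *; exact ⟨hb.2, hb.1⟩, by simp⟩

lemma rr_simple_ne (n i j : ℕ) (x : Equiv.Perm (Fin n)) (h : j ≠ i) :
    rr n j (simpleT n i * x) = rr n j x := by
  by_cases hv : 1 ≤ i ∧ i < n
  · unfold rr
    congr 1
    apply Finset.filter_congr
    intro k _
    rw [Equiv.Perm.mul_apply, simpleT_val n i hv]
    split_ifs <;> omega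
  · rw [simpleT_invalid n i hv, one_mul]

lemma rr_word_not_mem (n j : ℕ) (a : List ℕ) (x : Equiv.Perm (Fin n)) (h : j ∉ a) :
    rr n j (WP n a * x) = rr n j x := by
  induction a with
  | nil => rw [WP_nil, one_mul]
  | cons k a ih =>
    simp at h
    rw [WP_cons, mul_assoc, rr_simple_ne _ _ _ _ h.1, ih h.2]

lemma WP_inv (n : ℕ) (a : List ℕ) : (WP n a)⁻¹ = WP n a.reverse := by
  induction a with
  | nil => simp [WP_nil]
  | cons k a ih => rw [WP_cons, mul_inv_rev, ih, List.reverse_cons, WP_append, WP_cons, WP_nil,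
      mul_one, simpleT_inv]

lemma rr_word_not_mem_right (n j : ℕ) (a : List ℕ) (x : Equiv.Perm (Fin n)) (h : j ∉ a) :
    rr n j (x * WP n a) = rr n j x := by
  rw [← rr_inv, mul_inv_rev, WP_inv, rr_word_not_mem _ _ _ _ (by simpa using h), rr_inv]

lemma rr_simple_le (n i : ℕ) (x : Equiv.Perm (Fin n)) :
    rr n i (simpleT n i * x) ≤ rr n i x + 1 := by
  by_cases hv : 1 ≤ i ∧ i < n
  · unfold rr
    refine le_trans (Finset.card_le_card (t := insert (x⁻¹ ⟨i - 1, by omega⟩) 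
      (Finset.univ.filter fun k : Fin n => k.val < i ∧ i ≤ (x k).val)) ?_) 
      (Finset.card_insert_le _ _)
    intro k
    simp only [Finset.mem_filter, Finset.mem_univ, true_and, Equiv.Perm.mul_apply,
      simpleT_val n i hv, Finset.mem_insert, Equiv.Perm.eq_inv_iff_eq, Fin.ext_iff]
    split_ifs <;> omega
  · rw [simpleT_invalid n i hv, one_mul]; omega

lemma rr_simple_eq (n : ℕ) (x : Equiv.Perm (Fin n)) (p q : Fin n) (hpq : p.val + 1 = q.val)
    (h1 : (x⁻¹ p).val < q.val) (h2 : q.val ≤ (x⁻¹ q).val) :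
    rr n q.val (simpleT n q.val * x) = rr n q.val x + 1 := by
  have hv : 1 ≤ q.val ∧ q.val < n := ⟨by omega, q.isLt⟩
  unfold rr
  rw [← Finset.card_insert_of_notMem (a := x⁻¹ p)]
  · congr 1
    ext k
    have e1 : k = x⁻¹ p ↔ (x k).val = p.val := by rw [Equiv.Perm.eq_inv_iff_eq, Fin.ext_iff]
    have e2 : k = x⁻¹ q ↔ (x k).val = q.val := by rw [Equiv.Perm.eq_inv_iff_eq, Fin.ext_iff]
    have e1' : k = x⁻¹ p → k.val = (x⁻¹ p).val := fun h => by rw [h]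
    have e2' : k = x⁻¹ q → k.val = (x⁻¹ q).val := fun h => by rw [h]
    simp only [Finset.mem_filter, Finset.mem_univ, true_and, Equiv.Perm.mul_apply,
      simpleT_val n _ hv, Finset.mem_insert]
    split_ifs <;> grind
  · simp; omega

lemma rr_simple_conv (n : ℕ) (x : Equiv.Perm (Fin n)) (p q : Fin n) (hpq : p.val + 1 = q.val)
    (h : rr n q.val (simpleT n q.val * x) = rr n q.val x + 1) :
    (x⁻¹ p).val < q.val ∧ q.val ≤ (x⁻¹ q).val := by
  have hv : 1 ≤ q.val ∧ q.val < n := ⟨by omega, q.isLt⟩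
  constructor
  · by_contra hc
    have : rr n q.val (simpleT n q.val * x) ≤ rr n q.val x := by
      apply Finset.card_le_card
      intro k
      have e1 : k = x⁻¹ p ↔ (x k).val = p.val := by rw [Equiv.Perm.eq_inv_iff_eq, Fin.ext_iff]
      have e1' : k = x⁻¹ p → k.val = (x⁻¹ p).val := fun h => by rw [h]
      simp only [Finset.mem_filter, Finset.mem_univ, true_and, Equiv.Perm.mul_apply,
        simpleT_val n _ hv]
      split_ifs <;> grind
    omega
  · by_contra hc
    have : rr n q.val (simpleT n q.val * x) ≤ rr n q.val x := by
      rw [rr_dual, rr_dual]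
      apply Finset.card_le_card
      intro k
      have e1 : k = x⁻¹ q ↔ (x k).val = q.val := by rw [Equiv.Perm.eq_inv_iff_eq, Fin.ext_iff]
      have e1' : k = x⁻¹ q → k.val = (x⁻¹ q).val := fun h => by rw [h]
      simp only [Finset.mem_filter, Finset.mem_univ, true_and, Equiv.Perm.mul_apply,
        simpleT_val n _ hv]
      split_ifs <;> grind
    omega

lemma rr_one (n j : ℕ) : rr n j 1 = 0 := by
  unfold rr
  rw [Finset.card_eq_zero, Finset.filter_eq_empty_iff]
  intro k _; rw [Equiv.Perm.one_apply]; omega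

lemma rr_le_count (n j : ℕ) (a : List ℕ) : rr n j (WP n a) ≤ a.count j := by
  induction a with
  | nil => rw [WP_nil, rr_one]; omega
  | cons k a ih =>
    rw [WP_cons]
    by_cases h : j = k
    · subst h
      have := rr_simple_le n j (WP n a)
      rw [List.count_cons_self]; omega
    · rw [rr_simple_ne _ _ _ _ h, List.count_cons_of_ne (Ne.symm h)]; exact ih

lemma rr_zero_pos (n : ℕ) (x : Equiv.Perm (Fin n)) (j : ℕ) (h : rr n j x = 0) (p : Fin n) :
    (x⁻¹ p).val < j ↔ p.val < j := by
  have h' := h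
  rw [rr_dual] at h'
  unfold rr at h
  rw [Finset.card_eq_zero] at h h'
  have a1 : x⁻¹ p ∉ (∅ : Finset (Fin n)) := by simp
  have a2 := a1
  nth_rw 1 [← h] at a1
  nth_rw 1 [← h'] at a2
  simp only [Finset.mem_filter, Finset.mem_univ, true_and, perm_app_inv] at a1 a2
  omega

lemma rr_count_one (n j : ℕ) (hv : 1 ≤ j ∧ j < n) (a : List ℕ) (h : a.count j = 1) :
    rr n j (WP n a) = 1 := by
  induction a with
  | nil => simp at h
  | cons k a ih =>
    rw [WP_cons]
    by_cases hk : j = k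
    · subst hk
      rw [List.count_cons_self] at h
      have h0 := rr_le_count n j a
      have h0' : rr n j (WP n a) = 0 := by omega
      have := rr_simple_eq n (WP n a) ⟨j - 1, by omega⟩ ⟨j, hv.2⟩ (by simp; omega)
        ((rr_zero_pos n _ j h0' _).2 (by simp; omega))
        (by have := (rr_zero_pos n _ j h0' ⟨j, hv.2⟩); simp at this ⊢; exact this)
      simp only at this
      rw [this, h0']
    · rw [rr_simple_ne _ _ _ _ hk]
      rw [List.count_cons_of_ne (Ne.symm hk)] at h; exact ih h

def av {n : ℕ} (w : Equiv.Perm (Fin n)) : Prop :=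
  ∀ a b c, a < b → b < c → w b < w a → w c < w b → False

lemma av_top {n : ℕ} {w : Equiv.Perm (Fin n)} (h : av w) {k l : Fin n} (hkl : k < l)
    (hw : w l < w k) : k.val < (w k).val := by
  have h1 : ((insert l (Finset.Iio k)).image w) ⊆ Finset.Iio (w k) := by
    intro v hv
    simp only [Finset.mem_image, Finset.mem_insert, Finset.mem_Iio] at hv ⊢
    obtain ⟨p, rfl | hp, rfl⟩ := hv
    · exact hw
    · rcases lt_trichotomy (w p) (w k) with h2 | h2 | h2
      · exact h2
      · exact absurd (w.injective h2) hp.ne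
      · exact (h p k l hp hkl h2 hw).elim
  have h2 := Finset.card_le_card h1
  rw [Finset.card_image_of_injective _ w.injective, Finset.card_insert_of_notMem (by
    simp; exact hkl.le), Fin.card_Iio, Fin.card_Iio] at h2
  omega

lemma av_bot {n : ℕ} {w : Equiv.Perm (Fin n)} (h : av w) {k l : Fin n} (hkl : k < l)
    (hw : w l < w k) : (w l).val < l.val := by
  have h1 : ((insert k (Finset.Ioi l)).image w) ⊆ Finset.Ioi (w l) := by
    intro v hv
    simp only [Finset.mem_image, Finset.mem_insert, Finset.mem_Ioi] at hv ⊢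
    obtain ⟨p, rfl | hp, rfl⟩ := hv
    · exact hw
    · rcases lt_trichotomy (w l) (w p) with h2 | h2 | h2
      · exact h2
      · exact absurd (w.injective h2) hp.ne
      · exact (h k l p hkl hp hw h2).elim
  have h2 := Finset.card_le_card h1
  rw [Finset.card_image_of_injective _ w.injective, Finset.card_insert_of_notMem (by
    simp; exact hkl.le), Fin.card_Ioi, Fin.card_Ioi] at h2
  omega

lemma av_iff_count (n : ℕ) (a : List ℕ) (hr : Red n a) :
    av (WP n a) ↔ ∀ j, rr n j (WP n a) = a.count j := by
  induction a with
  | nil =>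
    simp only [WP_nil, rr_one, List.count_nil, implies_true, iff_true]
    intro a b c h1 h2 h3 h4
    simp at h3; exact absurd h1 (not_lt.mpr h3.le)
  | cons i a ih =>
    have hv := hr.valid
    obtain ⟨p, q, hpq, rfl⟩ : ∃ p q : Fin n, p.val + 1 = q.val ∧ q.val = i :=
      ⟨⟨i - 1, by omega⟩, ⟨i, hv.2⟩, by simp; omega, rfl⟩
    have hasc := hr.ascent p hpq
    have ih := ih hr.tail
    rw [WP_cons]
    set y := WP n a with hy
    have hflip : ∀ k l : Fin n, y k < y l →
      ¬ simpleT n q.val (y k) < simpleT n q.val (y l) → k = y⁻¹ p ∧ l = y⁻¹ q := by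
      intro k l h1 h2
      obtain ⟨-, e1, e2, -⟩ := simple_flip n q.val _ _ h1 h2
      constructor
      · rw [Equiv.Perm.eq_inv_iff_eq, Fin.ext_iff]; omega
      · rw [Equiv.Perm.eq_inv_iff_eq, Fin.ext_iff]; omega
    have hlt : ∀ k l : Fin n, k < l → y l < y k →
      simpleT n q.val (y l) < simpleT n q.val (y k) := by
      intro k l h1 h2
      by_contra h3
      obtain ⟨rfl, rfl⟩ := hflip _ _ h2 h3
      exact absurd h1 (not_lt.mpr hasc.le)
    have hlt' : ∀ k l : Fin n, k < l → simpleT n q.val (y l) < simpleT n q.val (y k) →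
      y l < y k ∨ (k = y⁻¹ p ∧ l = y⁻¹ q) := by
      intro k l h1 h2
      rcases lt_trichotomy (y l) (y k) with h3 | h3 | h3
      · exact Or.inl h3
      · rw [h3] at h2; exact absurd h2 (lt_irrefl _)
      · exact Or.inr (hflip _ _ h3 (not_lt.mpr h2.le))
    have ep : simpleT n q.val p = q := by
      apply Fin.ext; rw [simpleT_val n _ hv]; simp [hpq]
    have eq : simpleT n q.val q = p := by
      apply Fin.ext; rw [simpleT_val n _ hv]; simp; omega
    constructor
    · intro h j
      have hy : av y := fun a b c h1 h2 h3 h4 =>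
        h a b c h1 h2 (hlt _ _ h1 h3) (hlt _ _ h2 h4)
      have hc := ih.1 hy
      by_cases hj : j = q.val
      · subst hj
        have hinv : (simpleT n q.val * y) (y⁻¹ q) < (simpleT n q.val * y) (y⁻¹ p) := by
          simp only [Equiv.Perm.mul_apply, perm_app_inv, ep, eq]
          rw [Fin.lt_def]; omega
        have t1 := av_top h hasc hinv
        have t2 := av_bot h hasc hinv
        simp only [Equiv.Perm.mul_apply, perm_app_inv, ep, eq] at t1 t2
        rw [rr_simple_eq n y p q hpq t1 (by omega), hc, List.count_cons_self]
      · rw [rr_simple_ne _ _ _ _ hj, List.count_cons_of_ne (Ne.symm hj)]; exact hc j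
    · intro h
      have hc : ∀ j, rr n j y = a.count j := by
        intro j
        have := h j
        by_cases hj : j = q.val
        · subst hj
          rw [List.count_cons_self] at this
          have h1 := rr_simple_le n q.val y
          have h2 := rr_le_count n q.val a
          rw [← hy] at h2
          omega
        · rwa [rr_simple_ne _ _ _ _ hj, List.count_cons_of_ne (Ne.symm hj)] at this
      have hay := ih.2 hc
      obtain ⟨c1, c2⟩ := rr_simple_conv n y p q hpq (by
        rw [h q.val, hc q.val, List.count_cons_self])
      intro a b c h1 h2 h3 h4
      simp only [Equiv.Perm.mul_apply] at h3 h4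
      rcases hlt' _ _ h1 h3 with h5 | ⟨rfl, rfl⟩
      · rcases hlt' _ _ h2 h4 with h6 | ⟨rfl, rfl⟩
        · exact hay a b c h1 h2 h5 h6
        · have := av_bot hay h1 h5
          rw [perm_app_inv] at this
          omega
      · rcases hlt' _ _ h2 h4 with h6 | ⟨h6, -⟩
        · have := av_top hay h2 h6
          rw [perm_app_inv] at this
          omega
        · rw [h6] at h1; exact lt_irrefl _ h1


lemma avoids321_iff {n : ℕ} (w : Equiv.Perm (Fin n)) : AvoidsPattern w pattern321 ↔ av w := by
  constructor
  · intro h a b c h1 h2 h3 h4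
    apply h
    refine ⟨![a, b, c], ?_, ?_⟩
    · rw [Fin.strictMono_iff_lt_succ]
      intro i
      fin_cases i <;> simp [h1, h2]
    · have e0 : pattern321 0 = 2 := by decide
      have e1 : pattern321 1 = 1 := by decide
      have e2 : pattern321 2 = 0 := by decide
      intro x y
      have := h4.trans h3
      fin_cases x <;> fin_cases y <;> simp [e0, e1, e2, h3, h4, this, h3.le, h4.le, this.le]
  · rintro h ⟨j, hj, hp⟩
    exact h (j 0) (j 1) (j 2) (hj (by decide)) (hj (by decide)) ((hp 1 0).2 (by decide))
      ((hp 2 1).2 (by decide))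

def pat {n : ℕ} (w : Equiv.Perm (Fin n)) (a b c d : Fin n) : Prop :=
  a < b ∧ b < c ∧ c < d ∧ w c < w d ∧ w d < w a ∧ w a < w b

lemma occ_iff_pat {n : ℕ} (w : Equiv.Perm (Fin n)) (j : Fin 4 → Fin n) :
    IsPatternOcc w pattern3412 j ↔ pat w (j 0) (j 1) (j 2) (j 3) := by
  constructor
  · rintro ⟨hj, hp⟩
    exact ⟨hj (by decide), hj (by decide), hj (by decide), (hp 2 3).2 (by decide),
      (hp 3 0).2 (by decide), (hp 0 1).2 (by decide)⟩
  · rintro ⟨h1, h2, h3, h4, h5, h6⟩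
    refine ⟨?_, ?_⟩
    · rw [Fin.strictMono_iff_lt_succ]
      intro i
      fin_cases i <;> simp [h1, h2, h3]
    · have e0 : pattern3412 0 = 2 := by decide
      have e1 : pattern3412 1 = 3 := by decide
      have e2 : pattern3412 2 = 0 := by decide
      have e3 : pattern3412 3 = 1 := by decide
      have h45 := h4.trans h5
      have h56 := h5.trans h6
      have h46 := h4.trans h56
      intro x y
      fin_cases x <;> fin_cases y <;> simp [e0, e1, e2, e3, h4, h5, h6, h45, h56, h46, h4.le, h5.le,
        h6.le, h45.le, h56.le, h46.le]

lemma once_iff {n : ℕ} (w : Equiv.Perm (Fin n)) : ContainsPatternOnce w pattern3412 ↔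
    ∃ a b c d, pat w a b c d ∧ ∀ a' b' c' d', pat w a' b' c' d' →
      a' = a ∧ b' = b ∧ c' = c ∧ d' = d := by
  constructor
  · rintro ⟨j, hj, hu⟩
    refine ⟨j 0, j 1, j 2, j 3, (occ_iff_pat w j).1 hj, ?_⟩
    intro a b c d h
    have := hu ![a, b, c, d] ((occ_iff_pat w _).2 h)
    rw [← this]
    simp
  · rintro ⟨a, b, c, d, h, hu⟩
    refine ⟨![a, b, c, d], (occ_iff_pat w _).2 h, ?_⟩
    intro j hj
    obtain ⟨h0, h1, h2, h3⟩ := hu _ _ _ _ ((occ_iff_pat w j).1 hj)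
    funext i
    fin_cases i <;> simp [h0, h1, h2, h3]

lemma two_le_rr {n : ℕ} (w : Equiv.Perm (Fin n)) (j : ℕ) (a b : Fin n) (hab : a < b)
    (hb : b.val < j) (h1 : j ≤ (w a).val) (h2 : j ≤ (w b).val) : 2 ≤ rr n j w := by
  rw [← Finset.card_pair hab.ne]
  apply Finset.card_le_card
  intro k hk
  simp at hk
  rw [Fin.lt_def] at hab
  rcases hk with rfl | rfl <;> simp <;> omega

lemma two_le_rr' {n : ℕ} (w : Equiv.Perm (Fin n)) (j : ℕ) (c d : Fin n) (hcd : c < d)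
    (hc : j ≤ c.val) (h1 : (w c).val < j) (h2 : (w d).val < j) : 2 ≤ rr n j w := by
  rw [rr_dual, ← Finset.card_pair hcd.ne]
  apply Finset.card_le_card
  intro k hk
  simp at hk
  rw [Fin.lt_def] at hcd
  rcases hk with rfl | rfl <;> simp <;> omega

lemma pat_rr {n : ℕ} {w : Equiv.Perm (Fin n)} {a b c d : Fin n} (h : pat w a b c d) :
    2 ≤ rr n (b.val + 1) w ∧ 2 ≤ rr n c.val w ∧ 2 ≤ rr n (w a).val w ∧
      2 ≤ rr n ((w d).val + 1) w := by
  obtain ⟨h1, h2, h3, h4, h5, h6⟩ := h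
  rw [Fin.lt_def] at *
  refine ⟨?_, ?_, ?_, ?_⟩
  · by_cases hx : b.val + 1 ≤ (w a).val
    · exact two_le_rr w _ a b h1 (by omega) (by omega) (by omega)
    · exact two_le_rr' w _ c d h3 (by omega) (by omega) (by omega)
  · by_cases hx : c.val ≤ (w a).val
    · exact two_le_rr w _ a b h1 (by omega) (by omega) (by omega)
    · exact two_le_rr' w _ c d h3 (by omega) (by omega) (by omega)
  · by_cases hx : b.val < (w a).val
    · exact two_le_rr w _ a b h1 (by omega) (by omega) (by omega)
    · exact two_le_rr' w _ c d h3 (by omega) (by omega) (by omega)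
  · by_cases hx : b.val < (w d).val + 1
    · exact two_le_rr w _ a b h1 (by omega) (by omega) (by omega)
    · exact two_le_rr' w _ c d h3 (by omega) (by omega) (by omega)

lemma av_lt {n : ℕ} {w : Equiv.Perm (Fin n)} (h : av w) {a b c : Fin n} (h1 : a < b) (h2 : b < c)
    (h3 : w c < w b) : w a < w b := by
  rcases lt_trichotomy (w a) (w b) with h4 | h4 | h4
  · exact h4
  · exact absurd (w.injective h4) h1.ne
  · exact (h a b c h1 h2 h4 h3).elim

lemma av_lt' {n : ℕ} {w : Equiv.Perm (Fin n)} (h : av w) {a b c : Fin n} (h1 : a < b) (h2 : b < c)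
    (h3 : w b < w a) : w b < w c := by
  rcases lt_trichotomy (w b) (w c) with h4 | h4 | h4
  · exact h4
  · exact absurd (w.injective h4) h2.ne
  · exact (h a b c h1 h2 h3 h4).elim

lemma exists_pair_of_card {n : ℕ} (s : Finset (Fin n)) (h : 2 ≤ s.card) :
    ∃ a b, a ∈ s ∧ b ∈ s ∧ a < b := by
  obtain ⟨a, ha, b, hb, hab⟩ := Finset.one_lt_card.1 h
  rcases lt_or_gt_of_ne hab with h | h
  · exact ⟨a, b, ha, hb, h⟩
  · exact ⟨b, a, hb, ha, h⟩

lemma rr_pat {n : ℕ} {w : Equiv.Perm (Fin n)} (hw : av w) {j : ℕ} {a b c d : Fin n}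
    (hab : a < b) (hcd : c < d) (hb : b.val < j) (hc : j ≤ c.val) (wa : j ≤ (w a).val)
    (wb : j ≤ (w b).val) (wc : (w c).val < j) (wd : (w d).val < j) : pat w a b c d := by
  have hbc : b < c := by rw [Fin.lt_def]; omega
  refine ⟨hab, hbc, hcd, ?_, by rw [Fin.lt_def]; omega, ?_⟩
  · exact av_lt' hw hbc hcd (by rw [Fin.lt_def]; omega)
  · exact av_lt hw hab hbc (by rw [Fin.lt_def]; omega)

lemma rr_get {n : ℕ} {w : Equiv.Perm (Fin n)} {j : ℕ} (h : 2 ≤ rr n j w) :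
    ∃ c d : Fin n, c < d ∧ j ≤ c.val ∧ (w c).val < j ∧ (w d).val < j := by
  rw [rr_dual] at h
  obtain ⟨c, d, hc, hd, hcd⟩ := exists_pair_of_card _ h
  simp at hc hd
  exact ⟨c, d, hcd, hc.1, hc.2, hd.2⟩

lemma rr_get' {n : ℕ} {w : Equiv.Perm (Fin n)} {j : ℕ} (h : 2 ≤ rr n j w) :
    ∃ a b : Fin n, a < b ∧ b.val < j ∧ j ≤ (w a).val ∧ j ≤ (w b).val := by
  unfold rr at h
  obtain ⟨c, d, hc, hd, hcd⟩ := exists_pair_of_card _ h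
  simp at hc hd
  exact ⟨c, d, hcd, hd.1, hc.2, hd.2⟩

/-- The pattern condition in terms of the rank statistics. -/
lemma pattern_iff {n : ℕ} (w : Equiv.Perm (Fin n)) (hw : av w) :
    ContainsPatternOnce w pattern3412 ↔ ∃ j0, rr n j0 w = 2 ∧ ∀ j, j ≠ j0 → rr n j w ≤ 1 := by
  rw [once_iff]
  constructor
  · rintro ⟨a, b, c, d, hp, hu⟩
    have hbc : c.val = b.val + 1 := by
      obtain ⟨h1, h2, h3, h4, h5, h6⟩ := hp
      by_contra hne
      have hlt : b.val + 1 < c.val := by rw [Fin.lt_def] at h2; omega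
      let e : Fin n := ⟨b.val + 1, by omega⟩
      have hbe : b < e := by rw [Fin.lt_def]; simp [e]
      have hec : e < c := by rw [Fin.lt_def]; simpa [e] using hlt
      rcases lt_trichotomy (w e) (w a) with g | g | g
      · rcases lt_trichotomy (w e) (w d) with g' | g' | g'
        · have := hu a b e d ⟨h1, hbe, hec.trans h3, g', h5, h6⟩
          exact hec.ne this.2.2.1
        · exact (hec.trans h3).ne (w.injective g')
        · exact hw a e d (h1.trans hbe) (hec.trans h3) g g'
      · exact (h1.trans hbe).ne' (w.injective g)
      · have := hu a e c d ⟨h1.trans hbe, hec, h3, h4, h5, g⟩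
        exact hbe.ne' this.2.1
    have key : ∀ j, 2 ≤ rr n j w → j = b.val + 1 ∧ rr n j w ≤ 2 := by
      intro j hj
      obtain ⟨c', d', x1, x2, x3, x4⟩ := rr_get hj
      obtain ⟨a', b', y1, y2, y3, y4⟩ := rr_get' hj
      have hh := hu _ _ _ _ (rr_pat hw y1 x1 y2 x2 y3 y4 x3 x4)
      obtain ⟨rfl, rfl, rfl, rfl⟩ := hh
      refine ⟨by omega, ?_⟩
      rw [← Finset.card_pair y1.ne]
      apply Finset.card_le_card
      intro k hk
      simp at hk ⊢
      by_contra hne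
      push Not at hne
      rcases lt_or_gt_of_ne hne.1 with g | g
      · have := hu _ _ _ _ (rr_pat hw g x1 (by rw [Fin.lt_def] at y1; omega) x2 hk.2 y3 x3 x4)
        exact hne.1 this.1
      · have := hu _ _ _ _ (rr_pat hw g x1 hk.1 x2 y3 hk.2 x3 x4)
        exact hne.2 this.2.1
    have h2 := (pat_rr hp).1
    refine ⟨b.val + 1, le_antisymm (key _ h2).2 h2, ?_⟩
    intro j hj
    by_contra hc
    exact hj (key j (by omega)).1
  · rintro ⟨j0, h2, h1⟩
    obtain ⟨c, d, x1, x2, x3, x4⟩ := rr_get h2.ge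
    obtain ⟨a, b, y1, y2, y3, y4⟩ := rr_get' h2.ge
    have hp := rr_pat hw y1 x1 y2 x2 y3 y4 x3 x4
    have key : ∀ j, 2 ≤ rr n j w → j = j0 := by
      intro j hj
      by_contra hne
      have := h1 j hne
      omega
    refine ⟨a, b, c, d, hp, ?_⟩
    intro a' b' c' d' hp'
    obtain ⟨q1, q2, q3, q4⟩ := pat_rr hp
    obtain ⟨q1', q2', q3', q4'⟩ := pat_rr hp'
    have e1 := key _ q1
    have e2 := key _ q2
    have e3 := key _ q3
    have e4 := key _ q4
    have e1' := key _ q1'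
    have e2' := key _ q2'
    have e3' := key _ q3'
    have e4' := key _ q4'
    refine ⟨w.injective (Fin.ext ?_), Fin.ext ?_, Fin.ext ?_, w.injective (Fin.ext ?_)⟩ <;> omega


lemma simple_comm (n i j : ℕ) (h : i + 2 ≤ j ∨ j + 2 ≤ i) :
    Commute (simpleT n i) (simpleT n j) := by
  by_cases hi : 1 ≤ i ∧ i < n
  · by_cases hj : 1 ≤ j ∧ j < n
    · apply Equiv.Perm.ext
      intro k
      apply Fin.ext
      simp only [Equiv.Perm.mul_apply, simpleT_val n _ hi, simpleT_val n _ hj]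
      split_ifs <;> omega
    · rw [simpleT_invalid n j hj]; exact Commute.one_right _
  · rw [simpleT_invalid n i hi]; exact Commute.one_left _

lemma simple_braid (n i : ℕ) (h1 : 1 ≤ i) (h2 : i + 1 < n) :
    simpleT n i * (simpleT n (i + 1) * simpleT n i) =
      simpleT n (i + 1) * (simpleT n i * simpleT n (i + 1)) := by
  have e1 := swap_eq_simple n ⟨i - 1, by omega⟩ ⟨i, by omega⟩ (by simp; omega)
  have e2 := swap_eq_simple n ⟨i, by omega⟩ ⟨i + 1, by omega⟩ (by simp)
  simp only at e1 e2
  rw [← e1, ← e2, ← mul_assoc, ← mul_assoc]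
  rw [Equiv.swap_mul_swap_mul_swap (by simp [Fin.ext_iff]; omega) (by simp [Fin.ext_iff])]
  rw [Equiv.swap_comm (⟨i - 1, by omega⟩ : Fin n) ⟨i, by omega⟩,
    Equiv.swap_comm (⟨i, by omega⟩ : Fin n) ⟨i + 1, by omega⟩]
  rw [Equiv.swap_mul_swap_mul_swap (by simp [Fin.ext_iff]) (by simp [Fin.ext_iff]; omega),
    Equiv.swap_comm]

lemma comm_words (n : ℕ) (a b : List ℕ) (h : ∀ x ∈ a, ∀ y ∈ b, x + 2 ≤ y ∨ y + 2 ≤ x) :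
    Commute (WP n a) (WP n b) := by
  unfold WP
  apply Commute.list_prod_left
  intro x hx
  apply Commute.list_prod_right
  intro y hy
  rw [List.mem_map] at hx hy
  obtain ⟨x, hx, rfl⟩ := hx
  obtain ⟨y, hy, rfl⟩ := hy
  exact simple_comm n x y (h x hx y hy)

lemma comm_word (n i : ℕ) (b : List ℕ) (h : ∀ y ∈ b, i + 2 ≤ y ∨ y + 2 ≤ i) :
    Commute (simpleT n i) (WP n b) := by
  have := comm_words n [i] b (by simpa using h)
  simpa [WP_cons, WP_nil] using this

lemma split_list (n i : ℕ) (q : List ℕ) (h : ∀ l ∈ q, l ≠ i ∧ l ≠ i + 1 ∧ l + 1 ≠ i) :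
    WP n q = WP n (q.filter (fun l => l < i)) * WP n (q.filter (fun l => ¬ l < i)) := by
  induction q with
  | nil => simp [WP_nil]
  | cons l q ih =>
    have ih := ih (fun l hl => h l (List.mem_cons_of_mem _ hl))
    have hl := h l List.mem_cons_self
    by_cases hli : l < i
    · rw [List.filter_cons_of_pos (by simpa using hli), List.filter_cons_of_neg (by simpa using hli),
        WP_cons, WP_cons, ih, mul_assoc]
    · rw [List.filter_cons_of_neg (by simpa using hli), List.filter_cons_of_pos (by simpa using hli),
        WP_cons, WP_cons, ih]
      refine Commute.left_comm ?_ _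
      apply comm_word
      intro y hy
      rw [List.mem_filter] at hy
      have := h y (List.mem_cons_of_mem _ hy.1)
      have h3 : y < i := by simpa using hy.2
      omega

lemma split_list' (n i : ℕ) (q : List ℕ) (h : ∀ l ∈ q, l ≠ i ∧ l ≠ i + 1 ∧ l + 1 ≠ i) :
    WP n q = WP n (q.filter (fun l => ¬ l < i)) * WP n (q.filter (fun l => l < i)) := by
  rw [split_list n i q h]
  apply comm_words
  intro x hx y hy
  rw [List.mem_filter] at hx hy
  have h1 := h x hx.1
  have h2 := h y hy.1
  have h3 : x < i := by simpa using hx.2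
  have h4 : ¬ y < i := by simpa using hy.2
  omega

lemma group_shuffle {G : Type*} [Group G] {P a A E X Y F B R : G} (hA : Commute a A)
    (hX : Commute a X) (hY : Commute a Y) (hB : Commute a B) (hE : Commute E X) (hF : Commute F Y) :
    P * (a * (A * (E * (X * Y) * (F * B)) * (a * R))) =
      (P * A * X) * (a * E * F * a) * (Y * B * R) := by
  simp only [mul_assoc]
  rw [hA.left_comm, hE.left_comm, hX.left_comm, hF.symm.left_comm, hB.symm.left_comm,
    hY.symm.left_comm]

/-- type B core: the two neighbours `e, f` occur in this order -/
lemma normal_core (n i e f : ℕ) (p q1 q2 q3 r X Y : List ℕ)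
    (hq2 : WP n q2 = WP n X * WP n Y)
    (h1 : ∀ l ∈ q1, i + 2 ≤ l ∨ l + 2 ≤ i) (h3 : ∀ l ∈ q3, i + 2 ≤ l ∨ l + 2 ≤ i)
    (hX : ∀ l ∈ X, i + 2 ≤ l ∨ l + 2 ≤ i) (hY : ∀ l ∈ Y, i + 2 ≤ l ∨ l + 2 ≤ i)
    (hE : ∀ l ∈ X, e + 2 ≤ l ∨ l + 2 ≤ e) (hF : ∀ l ∈ Y, f + 2 ≤ l ∨ l + 2 ≤ f) :
    WP n (p ++ i :: ((q1 ++ e :: (q2 ++ f :: q3)) ++ i :: r)) =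
      WP n (p ++ q1 ++ X) * (simpleT n i * simpleT n e * simpleT n f * simpleT n i) *
        WP n (Y ++ q3 ++ r) := by
  have := group_shuffle (P := WP n p) (R := WP n r) (comm_word n i q1 h1) (comm_word n i X hX)
    (comm_word n i Y hY) (comm_word n i q3 h3) (comm_word n e X hE) (comm_word n f Y hF)
  simp only [WP_append, WP_cons, hq2]
  simp only [mul_assoc] at this ⊢
  exact this

def typeA (n i : ℕ) (w : Equiv.Perm (Fin n)) (m : ℕ) : Prop :=
  ∃ u v k, (k = i + 1 ∨ k + 1 = i) ∧ WP n (u ++ [i, k, i] ++ v) = w ∧ u.length + v.length + 3 = m ∧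
    i ∉ u ++ v ∧ k ∉ u ++ v

def typeB (n : ℕ) (w : Equiv.Perm (Fin n)) (m : ℕ) : Prop :=
  ∃ u v k, WP n (u ++ [k + 2, k + 1, k + 3, k + 2] ++ v) = w ∧ u.length + v.length + 4 = m ∧
    (u ++ v).Nodup ∧ k + 3 < n ∧ ∀ l ∈ u ++ v, (1 ≤ l ∧ l < n) ∧ (l < k + 1 ∨ k + 3 < l)

lemma typeB_aux (n i e f : ℕ) (a p q1 q2 q3 r : List ℕ) (hr : Red n a)
    (hef : (e = i + 1 ∧ f + 1 = i) ∨ (e + 1 = i ∧ f = i + 1))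
    (ha : a = p ++ i :: ((q1 ++ e :: (q2 ++ f :: q3)) ++ i :: r))
    (hn : (p ++ i :: ((q1 ++ e :: (q2 ++ f :: q3)) ++ r)).Nodup) : typeB n (WP n a) a.length := by
  have hvi := hr.valid_mem i (by simp [ha])
  have hve := hr.valid_mem e (by simp [ha])
  have hvf := hr.valid_mem f (by simp [ha])
  obtain ⟨k, rfl⟩ : ∃ k, i = k + 2 := ⟨i - 2, by omega⟩
  have hval := hr.valid_mem
  have hmem : ∀ l, l ∈ p ++ q1 ++ q2 ++ q3 ++ r → (1 ≤ l ∧ l < n) ∧ l ≠ k + 2 ∧ l ≠ e ∧ l ≠ f := by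
    intro l hl
    refine ⟨hval l (by rw [ha]; simp at hl ⊢; tauto), ?_⟩
    have hp : List.Perm (p ++ (k + 2) :: ((q1 ++ e :: (q2 ++ f :: q3)) ++ r))
      ([k + 2, e, f] ++ (p ++ q1 ++ q2 ++ q3 ++ r)) := by
      rw [List.perm_iff_count]; intro x; simp [List.count_cons]; omega
    have hn' := hp.nodup_iff.1 hn
    have hd := (List.nodup_append'.1 hn').2.2
    have := fun h => hd (a := l) h hl
    simp only [List.mem_cons, List.not_mem_nil, or_false] at this
    tauto
  have mq1 : ∀ l ∈ q1, (l < k + 1 ∨ k + 3 < l) := by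
    intro l hl; have := hmem l (by simp [hl]); omega
  have mq2 : ∀ l ∈ q2, (l < k + 1 ∨ k + 3 < l) := by
    intro l hl; have := hmem l (by simp [hl]); omega
  have mq3 : ∀ l ∈ q3, (l < k + 1 ∨ k + 3 < l) := by
    intro l hl; have := hmem l (by simp [hl]); omega
  have main : ∀ X Y : List ℕ, WP n q2 = WP n X * WP n Y → List.Perm (X ++ Y) q2 →
      (∀ l ∈ X, e + 2 ≤ l ∨ l + 2 ≤ e) → (∀ l ∈ Y, f + 2 ≤ l ∨ l + 2 ≤ f) →
      typeB n (WP n a) a.length := by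
    intro X Y hXY hperm hX hY
    have hXm : ∀ l ∈ X, l ∈ q2 := fun l hl => hperm.subset (by simp [hl])
    have hYm : ∀ l ∈ Y, l ∈ q2 := fun l hl => hperm.subset (by simp [hl])
    have core := normal_core n (k + 2) e f p q1 q2 q3 r X Y hXY
      (fun l hl => by have := mq1 l hl; omega) (fun l hl => by have := mq3 l hl; omega)
      (fun l hl => by have := mq2 l (hXm l hl); omega)
      (fun l hl => by have := mq2 l (hYm l hl); omega) hX hY
    have hcount : ∀ x, X.count x + Y.count x = q2.count x := by
      intro x; rw [← List.count_append]; exact hperm.count_eq x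
    have hpp : List.Perm ((p ++ q1 ++ X) ++ (Y ++ q3 ++ r)) (p ++ q1 ++ q2 ++ q3 ++ r) := by
      rw [List.perm_iff_count]; intro x
      have := hcount x
      simp only [List.count_append]; omega
    refine ⟨p ++ q1 ++ X, Y ++ q3 ++ r, k, ?_, ?_, ?_, by omega, ?_⟩
    · rw [ha, core, WP_append, WP_append]
      congr 2
      simp only [WP_cons, WP_nil, mul_one]
      rcases hef with ⟨h1, h2⟩ | ⟨h1, h2⟩
      · have h3 : f = k + 1 := by omega
        have h4 : e = k + 3 := by omega
        subst h3 h4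
        have := (simple_comm n (k + 1) (k + 3) (by omega)).eq
        rw [← mul_assoc (simpleT n (k + 1)), this]
        simp only [mul_assoc]
      · have h3 : e = k + 1 := by omega
        have h4 : f = k + 3 := by omega
        subst h3 h4
        simp only [mul_assoc]
    · have := hperm.length_eq
      rw [ha]
      simp at this ⊢; omega
    · rw [hpp.nodup_iff]
      refine hn.sublist ?_
      simp only [List.append_assoc, List.cons_append]
      refine List.Sublist.append_left (List.Sublist.cons _ (List.Sublist.append_left
        (List.Sublist.cons _ ?_) _)) _
      exact List.Sublist.append_left (List.Sublist.cons _ (List.Sublist.refl _)) _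
    · intro l hl
      have := hmem l (hpp.subset hl)
      omega
  have hq : ∀ l ∈ q2, l ≠ k + 2 ∧ l ≠ k + 2 + 1 ∧ l + 1 ≠ k + 2 := by
    intro l hl; have := mq2 l hl; omega
  rcases hef with ⟨h1, h2⟩ | ⟨h1, h2⟩
  · refine main _ _ (split_list n (k + 2) q2 hq) ?_ ?_ ?_
    · simpa only [decide_not] using List.filter_append_perm (fun l => decide (l < k + 2)) q2
    · intro l hl
      rw [List.mem_filter] at hl
      have := mq2 l hl.1
      have : l < k + 2 := by simpa using hl.2
      omega
    · intro l hl
      rw [List.mem_filter] at hl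
      have := mq2 l hl.1
      have : ¬ l < k + 2 := by simpa using hl.2
      omega
  · refine main _ _ (split_list' n (k + 2) q2 hq) ?_ ?_ ?_
    · refine List.perm_append_comm.trans ?_
      simpa only [decide_not] using List.filter_append_perm (fun l => decide (l < k + 2)) q2
    · intro l hl
      rw [List.mem_filter] at hl
      have := mq2 l hl.1
      have : ¬ l < k + 2 := by simpa using hl.2
      omega
    · intro l hl
      rw [List.mem_filter] at hl
      have := mq2 l hl.1
      have : l < k + 2 := by simpa using hl.2
      omega

lemma typeA_aux (n i k k' : ℕ) (a p q1 q2 r : List ℕ)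
    (hk : (k = i + 1 ∧ k' + 1 = i) ∨ (k + 1 = i ∧ k' = i + 1))
    (ha : a = p ++ i :: ((q1 ++ k :: q2) ++ i :: r))
    (hn : (p ++ i :: ((q1 ++ k :: q2) ++ r)).Nodup) (hk' : k' ∉ q1 ++ k :: q2) :
    typeA n i (WP n a) a.length := by
  have hmem : ∀ l, l ∈ p ++ q1 ++ q2 ++ r → l ≠ i ∧ l ≠ k := by
    intro l hl
    have hp : List.Perm (p ++ i :: ((q1 ++ k :: q2) ++ r))
      ([i, k] ++ (p ++ q1 ++ q2 ++ r)) := by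
      rw [List.perm_iff_count]; intro x; simp [List.count_cons]; omega
    have hn' := hp.nodup_iff.1 hn
    have hd := (List.nodup_append'.1 hn').2.2
    have := fun h => hd (a := l) h hl
    simp only [List.mem_cons, List.not_mem_nil, or_false] at this
    tauto
  have mq1 : ∀ l ∈ q1, i + 2 ≤ l ∨ l + 2 ≤ i := by
    intro l hl
    have := hmem l (by simp [hl])
    have : l ≠ k' := by rintro rfl; exact hk' (by simp [hl])
    omega
  have mq2 : ∀ l ∈ q2, i + 2 ≤ l ∨ l + 2 ≤ i := by
    intro l hl
    have := hmem l (by simp [hl])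
    have : l ≠ k' := by rintro rfl; exact hk' (by simp [hl])
    omega
  refine ⟨p ++ q1, q2 ++ r, k, by omega, ?_, ?_, ?_, ?_⟩
  · have h1 := comm_word n i q1 mq1
    have h2 := comm_word n i q2 mq2
    rw [ha]
    simp only [WP_append, WP_cons, WP_nil, mul_one, mul_assoc]
    rw [h1.left_comm, h2.symm.left_comm]
  · rw [ha]; simp; omega
  · intro h; exact (hmem i (by simpa using h)).1 rfl
  · intro h; exact (hmem k (by simpa using h)).2 rfl

theorem normal (n : ℕ) (a : List ℕ) (hr : Red n a) (i : ℕ) (p q r : List ℕ)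
    (ha : a = p ++ i :: (q ++ i :: r)) (hn : (p ++ i :: (q ++ r)).Nodup) :
    typeA n i (WP n a) a.length ∨ typeB n (WP n a) a.length := by
  have hvi := hr.valid_mem i (by simp [ha])
  obtain ⟨j, rfl⟩ : ∃ j, i = j + 1 := ⟨i - 1, by omega⟩
  by_cases h1 : j ∈ q
  · obtain ⟨q1, q2, rfl⟩ := List.append_of_mem h1
    by_cases h2 : j + 2 ∈ q1 ++ j :: q2
    · right
      have h3 : j + 2 ∈ q1 ∨ j + 2 ∈ q2 := by simpa using h2
      rcases h3 with h3 | h3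
      · obtain ⟨q3, q4, rfl⟩ := List.append_of_mem h3
        refine typeB_aux n (j + 1) (j + 2) j a p q3 q4 q2 r hr (by omega) ?_ ?_
        · rw [ha]; simp
        · simpa using hn
      · obtain ⟨q3, q4, rfl⟩ := List.append_of_mem h3
        exact typeB_aux n (j + 1) j (j + 2) a p q1 q3 q4 r hr (by omega) ha hn
    · left
      exact typeA_aux n (j + 1) j (j + 2) a p q1 q2 r (by omega) ha hn h2
  · by_cases h2 : j + 2 ∈ q
    · left
      obtain ⟨q1, q2, rfl⟩ := List.append_of_mem h2
      exact typeA_aux n (j + 1) (j + 2) j a p q1 q2 r (by omega) ha hn h1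
    · exfalso
      have hi : j + 1 ∉ q := by
        intro h
        have := (List.nodup_append'.1 hn).2.1
        rw [List.nodup_cons] at this
        exact this.1 (by simp [h])
      have hc := comm_word n (j + 1) q (by
        intro y hy
        have e1 : y ≠ j := by rintro rfl; exact h1 hy
        have e2 : y ≠ j + 2 := by rintro rfl; exact h2 hy
        have e3 : y ≠ j + 1 := by rintro rfl; exact hi hy
        omega)
      have := hr.le (b := p ++ (q ++ r)) (by
        rw [ha]
        simp only [WP_append, WP_cons]
        rw [hc.left_comm, simpleT_mul_self_assoc])
      rw [ha] at this
      simp at this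


def emb4 (n k : ℕ) (h : k + 3 < n) : Fin 4 ↪ Fin n :=
  ⟨fun x => ⟨k + x.val, by omega⟩, fun x y hxy => by
    simp [Fin.ext_iff] at hxy; exact Fin.ext hxy⟩

noncomputable def io (n k : ℕ) (h : k + 3 < n) : Equiv.Perm (Fin 4) →* Equiv.Perm (Fin n) :=
  Equiv.Perm.viaEmbeddingHom (emb4 n k h)

lemma io_inj (n k : ℕ) (h : k + 3 < n) : Function.Injective (io n k h) :=
  Equiv.Perm.viaEmbeddingHom_injective _

lemma io_simple (n k : ℕ) (h : k + 3 < n) (t : ℕ) (ht : 1 ≤ t ∧ t < 4) :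
    io n k h (simpleT 4 t) = simpleT n (k + t) := by
  have hv : 1 ≤ k + t ∧ k + t < n := by omega
  apply Equiv.Perm.ext
  intro x
  change (simpleT 4 t).viaEmbedding (emb4 n k h) x = _
  by_cases hx : x ∈ Set.range (emb4 n k h)
  · obtain ⟨y, rfl⟩ := hx
    rw [Equiv.Perm.viaEmbedding_apply]
    apply Fin.ext
    rw [simpleT_val n _ hv]
    change k + (simpleT 4 t y).val = _
    rw [simpleT_val 4 _ ht]
    change _ = if k + y.val + 1 = k + t then k + t else if k + y.val = k + t then k + t - 1 else k + y.val
    split_ifs <;> omega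
  · rw [Equiv.Perm.viaEmbedding_apply_of_notMem _ _ _ hx]
    have hx' : ¬ (k ≤ x.val ∧ x.val < k + 4) := by
      intro hh
      apply hx
      refine ⟨⟨x.val - k, by omega⟩, ?_⟩
      apply Fin.ext
      change k + (x.val - k) = x.val
      omega
    apply Fin.ext
    rw [simpleT_val n _ hv]
    split_ifs <;> omega

lemma io_word (n k : ℕ) (h : k + 3 < n) (b : List ℕ) (hb : ∀ t ∈ b, 1 ≤ t ∧ t < 4) :
    io n k h (WP 4 b) = WP n (b.map (fun t => k + t)) := by
  induction b with
  | nil => simp [WP_nil]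
  | cons t b ih =>
    rw [WP_cons, map_mul, io_simple n k h t (hb t List.mem_cons_self), List.map_cons, WP_cons,
      ih (fun s hs => hb s (List.mem_cons_of_mem _ hs))]

def wd (k : ℕ) (u v b : List ℕ) (T : Finset ℕ) : List ℕ :=
  u.filter (fun x => x ∈ T) ++ b.map (fun t => k + t) ++ v.filter (fun x => x ∈ T)

noncomputable def phi (n k : ℕ) (h : k + 3 < n) (u v : List ℕ) (c : Equiv.Perm (Fin 4))
    (T : Finset ℕ) : Equiv.Perm (Fin n) :=
  WP n (u.filter (fun x => x ∈ T)) * io n k h c * WP n (v.filter (fun x => x ∈ T))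

lemma phi_wd (n k : ℕ) (h : k + 3 < n) (u v b : List ℕ) (T : Finset ℕ)
    (hb : ∀ t ∈ b, 1 ≤ t ∧ t < 4) : WP n (wd k u v b T) = phi n k h u v (WP 4 b) T := by
  unfold wd phi
  rw [WP_append, WP_append, io_word n k h b hb]

lemma sublist_eq_filter {l' l : List ℕ} (h : l'.Sublist l) (hn : l.Nodup) :
    l' = l.filter (fun x => x ∈ l') := by
  induction h with
  | slnil => rfl
  | @cons l1 l2 a h ih =>
    rw [List.nodup_cons] at hn
    rw [List.filter_cons_of_neg (by simpa using fun hh => hn.1 (h.subset hh))]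
    exact ih hn.2
  | @cons_cons l1 l2 a h ih =>
    rw [List.nodup_cons] at hn
    rw [List.filter_cons_of_pos (by simp)]
    congr 1
    refine (ih hn.2).trans ?_
    apply List.filter_congr
    intro x hx
    have : x ≠ a := by rintro rfl; exact hn.1 hx
    simp [this]

structure Good (n k : ℕ) (u v : List ℕ) : Prop where
  hk : k + 3 < n
  nd : (u ++ v).Nodup
  mem : ∀ l ∈ u ++ v, (1 ≤ l ∧ l < n) ∧ (l < k + 1 ∨ k + 3 < l)

lemma wd_sub (k : ℕ) (u v b b' : List ℕ) (T T' : Finset ℕ) (hb : b'.Sublist b) (hT : T' ⊆ T) :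
    (wd k u v b' T').Sublist (wd k u v b T) := by
  unfold wd
  refine List.Sublist.append (List.Sublist.append ?_ (hb.map _)) ?_
  · exact List.monotone_filter_right _ (fun x hx => by simp at hx ⊢; exact hT hx)
  · exact List.monotone_filter_right _ (fun x hx => by simp at hx ⊢; exact hT hx)

lemma wd_struct {n k : ℕ} {u v : List ℕ} (g : Good n k u v) (b : List ℕ) (T : Finset ℕ)
    (z : List ℕ) (hz : z.Sublist (wd k u v b T)) :
    ∃ b' T', b'.Sublist b ∧ T' ⊆ T ∧ z = wd k u v b' T' := by
  unfold wd at hz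
  rw [List.sublist_append_iff] at hz
  obtain ⟨z1, v', rfl, hz1, hv'⟩ := hz
  rw [List.sublist_append_iff] at hz1
  obtain ⟨u', b1, rfl, hu', hb1⟩ := hz1
  rw [List.sublist_map_iff] at hb1
  obtain ⟨b', hb', rfl⟩ := hb1
  have hnd := List.nodup_append'.1 g.nd
  have hu2 := hu'.trans List.filter_sublist
  have hv2 := hv'.trans List.filter_sublist
  refine ⟨b', (u' ++ v').toFinset, hb', ?_, ?_⟩
  · intro x hx
    simp at hx
    rcases hx with hx | hx
    · have := hu'.subset hx
      simp at this; exact this.2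
    · have := hv'.subset hx
      simp at this; exact this.2
  · unfold wd
    congr 1
    · congr 1
      refine (sublist_eq_filter hu2 hnd.1).trans ?_
      apply List.filter_congr
      intro x hx
      have : x ∉ v' := fun h => hnd.2.2 hx (hv2.subset h)
      simp [this]
    · refine (sublist_eq_filter hv2 hnd.2.1).trans ?_
      apply List.filter_congr
      intro x hx
      have : x ∉ u' := fun h => hnd.2.2 (hu2.subset h) hx
      simp [this]

lemma phi_rr {n k : ℕ} {u v : List ℕ} (g : Good n k u v) (c : Equiv.Perm (Fin 4)) (T : Finset ℕ)
    (j : ℕ) (hj : j ∈ u ++ v) : rr n j (phi n k g.hk u v c T) = if j ∈ T then 1 else 0 := by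
  obtain ⟨b, hb⟩ := exists_reduced 4 c
  rw [isReducedWord_iff] at hb
  obtain ⟨rfl, hr⟩ := hb
  rw [← phi_wd n k g.hk u v b T hr.valid_mem]
  have hm := g.mem j hj
  have h0 : (b.map (fun t => k + t)).count j = 0 := by
    rw [List.count_eq_zero]
    intro h
    rw [List.mem_map] at h
    obtain ⟨t, ht, rfl⟩ := h
    have := hr.valid_mem t ht
    omega
  have h1 : (u ++ v).count j = 1 := List.count_eq_one_of_mem g.nd hj
  rw [List.count_append] at h1
  have hc : (wd k u v b T).count j = if j ∈ T then 1 else 0 := by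
    unfold wd
    rw [List.count_append, List.count_append, h0]
    split_ifs with h
    · rw [List.count_filter (by simpa using h), List.count_filter (by simpa using h)]
      omega
    · rw [List.count_eq_zero_of_not_mem (by simp [h]), List.count_eq_zero_of_not_mem (by simp [h])]
  split_ifs with h
  · exact rr_count_one n j hm.1 _ (by rw [hc, if_pos h])
  · have := rr_le_count n j (wd k u v b T)
    rw [hc, if_neg h] at this
    omega

lemma phi_inj {n k : ℕ} {u v : List ℕ} (g : Good n k u v) (c c' : Equiv.Perm (Fin 4))
    (T T' : Finset ℕ) (hT : T ⊆ (u ++ v).toFinset) (hT' : T' ⊆ (u ++ v).toFinset)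
    (h : phi n k g.hk u v c T = phi n k g.hk u v c' T') : c = c' ∧ T = T' := by
  have hTT : T = T' := by
    ext j
    by_cases hj : j ∈ u ++ v
    · have h1 := phi_rr g c T j hj
      have h2 := phi_rr g c' T' j hj
      rw [h, h2] at h1
      by_cases a1 : j ∈ T <;> by_cases a2 : j ∈ T' <;> simp [a1, a2] at h1 ⊢
    · constructor
      · intro hh; exact absurd (List.mem_toFinset.1 (hT hh)) hj
      · intro hh; exact absurd (List.mem_toFinset.1 (hT' hh)) hj
  subst hTT
  refine ⟨?_, rfl⟩
  unfold phi at h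
  exact io_inj n k g.hk (mul_left_cancel (mul_right_cancel h))

lemma sub_valid {b b' : List ℕ} (hb : ∀ t ∈ b, 1 ≤ t ∧ t < 4) (h : b'.Sublist b) :
    ∀ t ∈ b', 1 ≤ t ∧ t < 4 := fun t ht => hb t (h.subset ht)

lemma wd_red {n k : ℕ} {u v : List ℕ} (g : Good n k u v) (b : List ℕ) (hr : Red 4 b)
    (T : Finset ℕ) (hT : T ⊆ (u ++ v).toFinset) : Red n (wd k u v b T) := by
  obtain ⟨z, hz, e, hz'⟩ := deletion' n (wd k u v b T)
  obtain ⟨b', T', hb', hT', rfl⟩ := wd_struct g b T z hz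
  rw [phi_wd n k g.hk u v b T hr.valid_mem, phi_wd n k g.hk u v b' T' (sub_valid hr.valid_mem hb')]
    at e
  obtain ⟨e1, rfl⟩ := phi_inj g _ _ _ _ (hT'.trans hT) hT e
  have := hr.le e1
  rw [hb'.eq_of_length_le this] at hz'
  exact hz'

lemma phi_below {n k : ℕ} {u v : List ℕ} (g : Good n k u v) (c' : Equiv.Perm (Fin 4))
    (T' : Finset ℕ) (hT' : T' ⊆ (u ++ v).toFinset) (x : Equiv.Perm (Fin n)) :
    bruhatLE n x (phi n k g.hk u v c' T') ↔
      ∃ c T, bruhatLE 4 c c' ∧ T ⊆ T' ∧ phi n k g.hk u v c T = x := by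
  obtain ⟨b, hb⟩ := exists_reduced 4 c'
  rw [isReducedWord_iff] at hb
  obtain ⟨rfl, hr⟩ := hb
  rw [← phi_wd n k g.hk u v b T' hr.valid_mem, bruhat_iff n x _ (wd_red g b hr T' hT')]
  constructor
  · rintro ⟨z, hz, rfl⟩
    obtain ⟨b', T, hb', hT, rfl⟩ := wd_struct g b T' z hz
    exact ⟨WP 4 b', T, (bruhat_iff 4 _ b hr).2 ⟨b', hb', rfl⟩, hT,
      (phi_wd n k g.hk u v b' T (sub_valid hr.valid_mem hb')).symm⟩
  · rintro ⟨c, T, hc, hT, rfl⟩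
    obtain ⟨b', hb', rfl⟩ := (bruhat_iff 4 _ b hr).1 hc
    exact ⟨wd k u v b' T, wd_sub k u v b b' T' T hb' hT,
      phi_wd n k g.hk u v b' T (sub_valid hr.valid_mem hb')⟩

lemma phi_le {n k : ℕ} {u v : List ℕ} (g : Good n k u v) (c c' : Equiv.Perm (Fin 4))
    (T T' : Finset ℕ) (hT : T ⊆ (u ++ v).toFinset) (hT' : T' ⊆ (u ++ v).toFinset) :
    bruhatLE n (phi n k g.hk u v c T) (phi n k g.hk u v c' T') ↔ bruhatLE 4 c c' ∧ T ⊆ T' := by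
  rw [phi_below g c' T' hT']
  constructor
  · rintro ⟨c1, T1, h1, h2, h3⟩
    obtain ⟨rfl, rfl⟩ := phi_inj g _ _ _ _ (h2.trans hT') hT h3
    exact ⟨h1, h2⟩
  · rintro ⟨h1, h2⟩
    exact ⟨c, T, h1, h2, rfl⟩

lemma WP_3412 : WP 4 [2, 1, 3, 2] = pattern3412 := by decide

lemma red_3412 : Red 4 [2, 1, 3, 2] := by
  have h0 : Red 4 [] := by
    have := permLen_le 4 []
    unfold Red
    simp at *
    omega
  have h1 : Red 4 [2] := red_of_ascent (y := 2) h0 1 rfl (by decide)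
  have h2 : Red 4 [3, 2] := red_of_ascent (y := 3) h1 2 rfl (by decide)
  have h3 : Red 4 [1, 3, 2] := red_of_ascent (y := 1) h2 0 rfl (by decide)
  exact red_of_ascent (y := 2) h3 1 rfl (by decide)

lemma wd_full (k : ℕ) (u v b : List ℕ) :
    wd k u v b (u ++ v).toFinset = u ++ b.map (fun t => k + t) ++ v := by
  unfold wd
  rw [List.filter_eq_self.2 (by intro x hx; simp [hx]), List.filter_eq_self.2 (by
    intro x hx; simp [hx])]

abbrev IsoStmt (n : ℕ) (w : Equiv.Perm (Fin n)) (m : ℕ) : Prop :=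
  Nonempty
        ((fun x y : {v : Equiv.Perm (Fin n) // bruhatLE n v w} => bruhatLE n x.1 y.1) ≃r
          (fun p q : {v : Equiv.Perm (Fin 4) // bruhatLE 4 v pattern3412} ×
              Finset (Fin m) =>
            bruhatLE 4 p.1.1 q.1.1 ∧ p.2 ⊆ q.2))

lemma typeB_good {n : ℕ} {w : Equiv.Perm (Fin n)} {m : ℕ} (h : typeB n w m) :
    ∃ u v k, Good n k u v ∧ WP n (u ++ [k + 2, k + 1, k + 3, k + 2] ++ v) = w ∧
      Red n (u ++ [k + 2, k + 1, k + 3, k + 2] ++ v) := by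
  obtain ⟨u, v, k, h1, h2, h3, h4, h5⟩ := h
  have g : Good n k u v := ⟨h4, h3, h5⟩
  refine ⟨u, v, k, g, h1, ?_⟩
  have := wd_red g _ red_3412 _ (Finset.Subset.refl _)
  rw [wd_full] at this
  exact this

theorem typeB_iso {n : ℕ} {w : Equiv.Perm (Fin n)} {m : ℕ} (h : typeB n w m) :
    IsoStmt n w (permLen n w - 4) := by
  obtain ⟨u, v, k, g, hw, hr⟩ := typeB_good h
  have hlen : permLen n w - 4 = (u ++ v).toFinset.card := by
    rw [List.toFinset_card_of_nodup g.nd, ← hw, ← hr]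
    simp; omega
  rw [hlen]
  set Lf := (u ++ v).toFinset with hL
  have hwphi : phi n k g.hk u v pattern3412 Lf = w := by
    rw [← WP_3412, ← phi_wd n k g.hk u v _ _ red_3412.valid_mem, wd_full]
    exact hw
  let E := Lf.equivFinOfCardEq rfl
  let em : Fin Lf.card ↪ ℕ := ⟨fun i => (E.symm i).1, fun i j hij => 
    E.symm.injective (Subtype.ext hij)⟩
  have hsub : ∀ S : Finset (Fin Lf.card), S.map em ⊆ Lf := by
    intro S x hx
    rw [Finset.mem_map] at hx
    obtain ⟨i, -, rfl⟩ := hx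
    exact (E.symm i).2
  have hmem : ∀ (c : {v : Equiv.Perm (Fin 4) // bruhatLE 4 v pattern3412}) 
      (S : Finset (Fin Lf.card)), bruhatLE n (phi n k g.hk u v c.1 (S.map em)) w := by
    intro c S
    rw [← hwphi, phi_le g _ _ _ _ (hsub S) (Finset.Subset.refl _)]
    exact ⟨c.2, hsub S⟩
  let F : {v : Equiv.Perm (Fin 4) // bruhatLE 4 v pattern3412} × Finset (Fin Lf.card) →
    {v : Equiv.Perm (Fin n) // bruhatLE n v w} :=
    fun p => ⟨phi n k g.hk u v p.1.1 (p.2.map em), hmem p.1 p.2⟩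
  have hF : Function.Bijective F := by
    constructor
    · rintro ⟨c, S⟩ ⟨c', S'⟩ hh
      have := congrArg Subtype.val hh
      obtain ⟨h1, h2⟩ := phi_inj g _ _ _ _ (hsub S) (hsub S') this
      exact Prod.ext (Subtype.ext h1) (Finset.map_injective em h2)
    · rintro ⟨x, hx⟩
      have hx' := hx
      rw [← hwphi, phi_below g _ _ (Finset.Subset.refl _)] at hx'
      obtain ⟨c, T, hc, hT, rfl⟩ := hx'
      refine ⟨⟨⟨c, hc⟩, Finset.univ.filter (fun i => em i ∈ T)⟩, Subtype.ext ?_⟩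
      have : (Finset.univ.filter (fun i => em i ∈ T)).map em = T := by
        ext j
        simp only [Finset.mem_map, Finset.mem_filter, Finset.mem_univ, true_and]
        constructor
        · rintro ⟨i, hi, rfl⟩; exact hi
        · intro hj
          have : em (E ⟨j, hT hj⟩) = j := by
            change (E.symm (E ⟨j, hT hj⟩)).1 = j
            rw [Equiv.symm_apply_apply]
          exact ⟨E ⟨j, hT hj⟩, by rwa [this], this⟩
      simp only [F, this]
  refine ⟨RelIso.symm ⟨Equiv.ofBijective F hF, ?_⟩⟩
  rintro ⟨c, S⟩ ⟨c', S'⟩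
  change bruhatLE n (phi n k g.hk u v c.1 (S.map em)) (phi n k g.hk u v c'.1 (S'.map em)) ↔ _
  rw [phi_le g _ _ _ _ (hsub S) (hsub S'), Finset.map_subset_map]

theorem typeB_pattern {n : ℕ} {w : Equiv.Perm (Fin n)} {m : ℕ} (h : typeB n w m) :
    ContainsPatternOnce w pattern3412 ∧ AvoidsPattern w pattern321 := by
  obtain ⟨u, v, k, g, hw, hr⟩ := typeB_good h
  have hk := g.hk
  have hmu : ∀ l, k < l → l < k + 4 → l ∉ u ∧ l ∉ v := by
    intro l h1 h2
    constructor
    · intro hh; have := g.mem l (by simp [hh]); omega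
    · intro hh; have := g.mem l (by simp [hh]); omega
  have hcount2 : (u ++ [k + 2, k + 1, k + 3, k + 2] ++ v).count (k + 2) = 2 := by
    have := hmu (k + 2) (by omega) (by omega)
    simp [List.count_eq_zero_of_not_mem this.1, List.count_eq_zero_of_not_mem this.2]
  have hcount1 : ∀ j, j ≠ k + 2 → (u ++ [k + 2, k + 1, k + 3, k + 2] ++ v).count j ≤ 1 := by
    intro j hj
    have h0 := List.nodup_iff_count_le_one.1 g.nd j
    rw [List.count_append] at h0
    by_cases hb : k < j ∧ j < k + 4
    · have := hmu j hb.1 hb.2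
      have h3 : j = k + 1 ∨ j = k + 3 := by omega
      rcases h3 with rfl | rfl <;>
      simp [List.count_eq_zero_of_not_mem this.1, List.count_eq_zero_of_not_mem this.2]
    · have : [k + 2, k + 1, k + 3, k + 2].count j = 0 := by
        rw [List.count_eq_zero]; simp; omega
      rw [List.count_append, List.count_append, this]; omega
  have hrr : ∀ j, rr n j (WP n (u ++ [k + 2, k + 1, k + 3, k + 2] ++ v)) =
      (u ++ [k + 2, k + 1, k + 3, k + 2] ++ v).count j := by
    intro j
    have hle := rr_le_count n j (u ++ [k + 2, k + 1, k + 3, k + 2] ++ v)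
    by_cases hj : j = k + 2
    · subst hj
      refine le_antisymm hle ?_
      rw [hcount2]
      have := hmu (k + 2) (by omega) (by omega)
      rw [WP_append, rr_word_not_mem_right _ _ _ _ this.2, WP_append,
        rr_word_not_mem _ _ _ _ this.1]
      have v1 : 1 ≤ k + 1 ∧ k + 1 < n := by omega
      have v2 : 1 ≤ k + 2 ∧ k + 2 < n := by omega
      have v3 : 1 ≤ k + 3 ∧ k + 3 < n := by omega
      apply two_le_rr _ _ ⟨k, by omega⟩ ⟨k + 1, by omega⟩
      · rw [Fin.lt_def]; simp
      · simp
      · simp [WP_cons, WP_nil, simpleT_val n _ v1, simpleT_val n _ v2, simpleT_val n _ v3]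
      · simp [WP_cons, WP_nil, simpleT_val n _ v1, simpleT_val n _ v2, simpleT_val n _ v3]
    · have h1 := hcount1 j hj
      by_cases h0 : (u ++ [k + 2, k + 1, k + 3, k + 2] ++ v).count j = 1
      · rw [h0]
        exact rr_count_one n j (hr.valid_mem j (List.count_pos_iff.1 (by omega))) _ h0
      · omega
  have hav := (av_iff_count n _ hr).2 hrr
  rw [← hw]
  refine ⟨(pattern_iff _ hav).2 ⟨k + 2, by rw [hrr, hcount2], ?_⟩, (avoids321_iff _).2 hav⟩
  intro j hj
  rw [hrr]
  exact hcount1 j hj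


lemma decomp {i : ℕ} {a : List ℕ} (h : 2 ≤ a.count i) : ∃ p q r, a = p ++ i :: (q ++ i :: r) := by
  have h1 : i ∈ a := List.count_pos_iff.mp (by omega)
  obtain ⟨p, t, rfl, hp⟩ := List.eq_append_cons_of_mem h1
  have h2 : i ∈ t := by
    rw [List.count_append, List.count_eq_zero_of_not_mem hp, List.count_cons_self] at h
    exact List.count_pos_iff.mp (by omega)
  obtain ⟨q, r, rfl⟩ := List.append_of_mem h2
  exact ⟨p, q, r, rfl⟩

lemma typeA_rr {n i : ℕ} {a : List ℕ} (hr : Red n a) (h : typeA n i (WP n a) a.length) :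
    rr n i (WP n a) ≤ 1 := by
  obtain ⟨u, v, k, hk, hw, hl, hi, hk'⟩ := h
  have hr' : Red n (u ++ [i, k, i] ++ v) := by
    unfold Red
    rw [hw, ← hr]; simp; omega
  have vi := hr'.valid_mem i (by simp)
  have vk := hr'.valid_mem k (by simp)
  have hb : WP n [i, k, i] = WP n [k, i, k] := by
    simp only [WP_cons, WP_nil, mul_one]
    rcases hk with rfl | rfl
    · exact simple_braid n i vi.1 vk.2
    · exact (simple_braid n k vk.1 vi.2).symm
  have : WP n (u ++ [k, i, k] ++ v) = WP n a := by
    rw [← hw]; simp only [WP_append, hb]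
  rw [← this]
  refine (rr_le_count n i _).trans ?_
  have hki : k ≠ i := by omega
  simp only [List.mem_append, not_or] at hi
  simp only [List.count_append, List.count_eq_zero_of_not_mem hi.1,
    List.count_eq_zero_of_not_mem hi.2, List.count_cons, List.count_nil]
  simp [hki]

lemma forwardB {n : ℕ} {w : Equiv.Perm (Fin n)}
    (h1 : ContainsPatternOnce w pattern3412) (h2 : AvoidsPattern w pattern321) :
    ∃ m, typeB n w m := by
  obtain ⟨a, ha⟩ := exists_reduced n w
  rw [isReducedWord_iff] at ha
  obtain ⟨rfl, hr⟩ := ha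
  rw [avoids321_iff] at h2
  rw [pattern_iff _ h2] at h1
  rw [av_iff_count n a hr] at h2
  obtain ⟨i, hi, hj⟩ := h1
  have hc : a.count i = 2 := by rw [← h2, hi]
  obtain ⟨p, q, r, he⟩ := decomp (i := i) (a := a) (by omega)
  have hn : (p ++ i :: (q ++ r)).Nodup := by
    rw [List.nodup_iff_count_le_one]
    intro j
    by_cases hji : j = i
    · subst hji
      rw [he] at hc
      simp [List.count_append] at hc ⊢
      omega
    · have := hj j hji
      rw [h2, he] at this
      have hji' : ¬ i = j := fun h => hji h.symm
      simp [List.count_append, hji'] at this ⊢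
      omega
  rcases normal n a hr i p q r he hn with h | h
  · have := typeA_rr hr h
    omega
  · exact ⟨_, h⟩

def Atm {α : Type*} (r : α → α → Prop) (x : α) : Prop :=
  ∃ y, r y x ∧ y ≠ x ∧ ∀ z, r z x → z = x ∨ z = y

lemma Atm_map {α β : Type*} {r : α → α → Prop} {s : β → β → Prop} (e : r ≃r s) {x : α}
    (h : Atm r x) : Atm s (e x) := by
  obtain ⟨y, h1, h2, h3⟩ := h
  refine ⟨e y, e.map_rel_iff.mpr h1, fun h => h2 (e.injective h), fun z hz => ?_⟩
  obtain ⟨z, rfl⟩ := e.surjective z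
  rcases h3 z (e.map_rel_iff.mp hz) with h | h
  · left; rw [h]
  · right; rw [h]

lemma Atm_card {α β : Type*} {r : α → α → Prop} {s : β → β → Prop} (e : r ≃r s) :
    Nat.card {x // Atm r x} = Nat.card {x // Atm s x} := by
  refine Nat.card_congr (Equiv.subtypeEquiv e.toEquiv fun x => ⟨fun h => Atm_map e h, fun h => ?_⟩)
  have := Atm_map e.symm h
  simpa using this

lemma simple_inj {n i j : ℕ} (hj : 1 ≤ j ∧ j < n) (h : simpleT n i = simpleT n j) : i = j := by
  by_contra hne
  have h1 := rr_count_one n j hj [j] (by simp)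
  have h2 := rr_le_count n j [i]
  simp only [WP_cons, WP_nil, mul_one] at h1 h2
  rw [h, h1] at h2
  simp [hne] at h2

lemma simple_ne_one {n j : ℕ} (hj : 1 ≤ j ∧ j < n) : simpleT n j ≠ 1 := by
  intro h
  have h1 := rr_count_one n j hj [j] (by simp)
  simp only [WP_cons, WP_nil, mul_one, h, rr_one] at h1
  omega

lemma red_nil (n : ℕ) : Red n [] := by
  have := permLen_le n []
  unfold Red
  simp at this ⊢
  omega

lemma red_single {n j : ℕ} (hj : 1 ≤ j ∧ j < n) : Red n [j] := by
  obtain ⟨b, hb, hw, hr⟩ := deletion' n [j]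
  rcases List.sublist_singleton.mp hb with h | h
  · subst h
    simp only [WP_cons, WP_nil, mul_one] at hw
    exact absurd hw.symm (simple_ne_one hj)
  · subst h; exact hr

lemma atm_iff {n : ℕ} {a : List ℕ} (hr : Red n a) (x : {v : Equiv.Perm (Fin n) // bruhatLE n v (WP n a)}) :
    Atm (fun x y : {v : Equiv.Perm (Fin n) // bruhatLE n v (WP n a)} => bruhatLE n x.1 y.1) x ↔
      ∃ j ∈ a, simpleT n j = x.1 := by
  have hone : bruhatLE n 1 (WP n a) := (bruhat_iff n 1 a hr).mpr ⟨[], by simp, WP_nil n⟩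
  constructor
  · rintro ⟨y, h1, h2, h3⟩
    obtain ⟨x, hx⟩ := x
    obtain ⟨b, hb, hbx⟩ := (bruhat_iff n x a hr).mp hx
    obtain ⟨c, hc, hcx, hcr⟩ := deletion' n b
    rw [hbx] at hcx
    subst hcx
    dsimp only at h1 h3 ⊢
    cases c with
    | nil =>
      obtain ⟨d, hd, hdy⟩ := (bruhat_iff n _ _ hcr).mp h1
      rw [List.sublist_nil] at hd
      subst hd
      exact absurd (Subtype.ext hdy.symm) h2
    | cons j c =>
      have hv := hcr.valid
      have hja : j ∈ a := hb.subset (hc.subset (by simp))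
      refine ⟨j, hja, ?_⟩
      have e1 := h3 ⟨1, hone⟩ ((bruhat_iff n _ _ hcr).mpr ⟨[], by simp, WP_nil n⟩)
      have hS : InSub n (simpleT n j) (j :: c) := ⟨[j], by simp, by simp [WP_cons, WP_nil]⟩
      have hS' : bruhatLE n (simpleT n j) (WP n a) := (bruhat_iff n _ _ hr).mpr
        ⟨[j], by simpa using hja, by simp [WP_cons, WP_nil]⟩
      have e2 := h3 ⟨simpleT n j, hS'⟩ ((bruhat_iff n _ _ hcr).mpr hS)
      rcases e2 with e2 | e2
      · exact congrArg Subtype.val e2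
      · rcases e1 with e1 | e1
        · have := hcr.le (b := []) (by rw [WP_nil]; exact congrArg Subtype.val e1)
          simp at this
        · have := congrArg Subtype.val (e2.trans e1.symm)
          exact absurd this (simple_ne_one hv)
  · rintro ⟨j, hj, hx⟩
    obtain ⟨x, hx'⟩ := x
    dsimp only at hx
    subst hx
    have hv := hr.valid_mem j hj
    have hw : simpleT n j = WP n [j] := by simp [WP_cons, WP_nil]
    refine ⟨⟨1, hone⟩, ?_, ?_, ?_⟩
    · dsimp only
      rw [hw]
      exact (bruhat_iff n _ _ (red_single hv)).mpr ⟨[], by simp, WP_nil n⟩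
    · intro h
      exact simple_ne_one hv (congrArg Subtype.val h).symm
    · rintro ⟨z, hz'⟩ hz
      dsimp only at hz
      rw [hw] at hz
      obtain ⟨d, hd, rfl⟩ := (bruhat_iff n _ _ (red_single hv)).mp hz
      rcases List.sublist_singleton.mp hd with h | h
      · subst h; right; exact Subtype.ext (WP_nil n)
      · subst h; left; exact Subtype.ext hw.symm

lemma atm_count {n : ℕ} {a : List ℕ} (hr : Red n a) :
    Nat.card {x // Atm (fun x y : {v : Equiv.Perm (Fin n) // bruhatLE n v (WP n a)} =>
      bruhatLE n x.1 y.1) x} = a.toFinset.card := by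
  have hS : ∀ j ∈ a, bruhatLE n (simpleT n j) (WP n a) := fun j hj => (bruhat_iff n _ _ hr).mpr
        ⟨[j], by simpa using hj, by simp [WP_cons, WP_nil]⟩
  symm
  rw [← Fintype.card_coe, ← Nat.card_eq_fintype_card]
  refine Nat.card_eq_of_bijective (fun j : a.toFinset =>
    ⟨⟨simpleT n j.1, hS j.1 (List.mem_toFinset.mp j.2)⟩,
      (atm_iff hr _).mpr ⟨j.1, List.mem_toFinset.mp j.2, rfl⟩⟩) ⟨?_, ?_⟩
  · intro i j h
    have := congrArg (fun x => x.1.1) h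
    exact Subtype.ext (simple_inj (hr.valid_mem j.1 (List.mem_toFinset.mp j.2)) this)
  · rintro ⟨⟨x, hx⟩, hx'⟩
    obtain ⟨j, hj, h⟩ := (atm_iff hr _).mp hx'
    exact ⟨⟨j, List.mem_toFinset.mpr hj⟩, Subtype.ext (Subtype.ext h)⟩

def SF (n : ℕ) (a : List ℕ) : Finset (Equiv.Perm (Fin n)) := (a.sublists.map (WP n)).toFinset

lemma mem_SF {n : ℕ} {a : List ℕ} {x : Equiv.Perm (Fin n)} : x ∈ SF n a ↔ InSub n x a := by
  simp [SF, InSub]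

lemma SF_card {n : ℕ} {a : List ℕ} (hr : Red n a) :
    Nat.card {v : Equiv.Perm (Fin n) // bruhatLE n v (WP n a)} = (SF n a).card :=
  Nat.subtype_card _ fun x => by rw [mem_SF, bruhat_iff n x a hr]

lemma SF_le {n : ℕ} (a : List ℕ) : (SF n a).card ≤ 2 ^ a.length := by
  refine (List.toFinset_card_le _).trans ?_
  rw [List.length_map, List.length_sublists]

lemma SF_append {n : ℕ} (a b : List ℕ) : (SF n (a ++ b)).card ≤ (SF n a).card * (SF n b).card := by
  have : SF n (a ++ b) ⊆ Finset.image₂ (fun x y => x * y) (SF n a) (SF n b) := by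
    intro x hx
    obtain ⟨c, hc, rfl⟩ := mem_SF.mp hx
    obtain ⟨c1, c2, rfl, h1, h2⟩ := List.sublist_append_iff.mp hc
    rw [WP_append]
    exact Finset.mem_image₂_of_mem (mem_SF.mpr ⟨c1, h1, rfl⟩) (mem_SF.mpr ⟨c2, h2, rfl⟩)
  exact (Finset.card_le_card this).trans (Finset.card_image₂_le _ _ _)

lemma SF_iki (n i k : ℕ) : (SF n [i, k, i]).card ≤ 6 := by
  have : SF n [i, k, i] ⊆ ([1, simpleT n i, simpleT n k, simpleT n i * simpleT n k,
      simpleT n k * simpleT n i, simpleT n i * (simpleT n k * simpleT n i)] :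
        List (Equiv.Perm (Fin n))).toFinset := by
    intro x hx
    have hx' : x ∈ ([i, k, i].sublists.map (WP n)).toFinset := hx
    have hs : [i, k, i].sublists = [[], [i], [k], [i, k], [i], [i, i], [k, i], [i, k, i]] := by
      rfl
    rw [hs] at hx'
    simp only [List.map_cons, List.map_nil, WP_cons, WP_nil, mul_one, simpleT_mul_self,
      List.mem_toFinset, List.mem_cons, List.not_mem_nil, or_false] at hx' ⊢
    rcases hx' with h | h | h | h | h | h | h | h <;> rw [h] <;> simp only [true_or, or_true]
  exact (Finset.card_le_card this).trans (List.toFinset_card_le _)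

lemma card_3412 : Nat.card {v : Equiv.Perm (Fin 4) // bruhatLE 4 v pattern3412} = 14 := by
  rw [← WP_3412, SF_card red_3412]
  decide +kernel

lemma typeB_ref (m : ℕ) : typeB (m + 4) (WP (m + 4) ([2, 1, 3, 2] ++ List.range' 4 m)) (m + 4) := by
  refine ⟨[], List.range' 4 m, 0, by simp, by simp, by simp [List.nodup_range'], by omega, ?_⟩
  intro l hl
  simp only [List.nil_append, List.mem_range'_1] at hl
  omega

lemma iso_atoms {n m : ℕ} {w : Equiv.Perm (Fin n)} (h : IsoStmt n w m) {a : List ℕ} (hr : Red n a)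
    (ha : WP n a = w) : a.toFinset.card = m + 3 := by
  subst ha
  obtain ⟨e⟩ := h
  have hB := typeB_ref m
  have hi := typeB_iso hB
  have hr0 : Red (m + 4) ([2, 1, 3, 2] ++ List.range' 4 m) := by
    have g : Good (m + 4) 0 [] (List.range' 4 m) := by
      refine ⟨by omega, by simp [List.nodup_range'], ?_⟩
      intro l hl
      simp only [List.nil_append, List.mem_range'_1] at hl
      omega
    have := wd_red g _ red_3412 _ (Finset.Subset.refl _)
    rw [wd_full] at this
    exact this
  have hm : permLen (m + 4) (WP (m + 4) ([2, 1, 3, 2] ++ List.range' 4 m)) - 4 = m := by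
    rw [← hr0]; simp
  rw [hm] at hi
  obtain ⟨e0⟩ := hi
  rw [← atm_count hr, Atm_card (e.trans e0.symm), atm_count hr0, List.toFinset_append,
    Finset.card_union_of_disjoint, List.toFinset_card_of_nodup (List.nodup_range' ..)]
  · simp
    have : ({2, 1, 3, 2} : Finset ℕ).card = 3 := by decide
    omega
  · rw [Finset.disjoint_left]
    intro x hx hx'
    simp [List.mem_range'_1] at hx hx'
    omega

lemma backwardB {n : ℕ} {w : Equiv.Perm (Fin n)} (h : IsoStmt n w (permLen n w - 4)) :
    ∃ m, typeB n w m := by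
  obtain ⟨a, ha⟩ := exists_reduced n w
  rw [isReducedWord_iff] at ha
  obtain ⟨rfl, hr⟩ := ha
  have hat := iso_atoms h hr rfl
  obtain ⟨e⟩ := h
  have hcard := Nat.card_congr e.toEquiv
  rw [SF_card hr, Nat.card_prod, card_3412, Nat.card_eq_fintype_card, Fintype.card_finset,
    Fintype.card_fin] at hcard
  have hlen : permLen n (WP n a) = a.length := hr.symm
  rw [hlen] at hcard hat
  have h4 : 4 ≤ a.length := by
    by_contra hlt
    have h0 : a.length - 4 = 0 := by omega
    have h1 := SF_le (n := n) a
    have h2 : 2 ^ a.length ≤ 2 ^ 3 := Nat.pow_le_pow_right (by norm_num) (by omega)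
    rw [hcard, h0] at h1
    omega
  have hnd : ¬ a.Nodup := by
    intro hn
    rw [List.toFinset_card_of_nodup hn] at hat
    omega
  rw [List.nodup_iff_count_le_one] at hnd
  push Not at hnd
  obtain ⟨i, hi⟩ := hnd
  obtain ⟨p, q, r, he⟩ := decomp (i := i) (a := a) (by omega)
  have hn : (p ++ i :: (q ++ r)).Nodup := by
    have h1 : (p ++ i :: (q ++ r)).toFinset = a.toFinset := by
      rw [he]; ext x; simp
    have h2 : (p ++ i :: (q ++ r)).length + 1 = a.length := by
      rw [he]; simp
      try omega
    have h3 : (p ++ i :: (q ++ r)).toFinset.card = (p ++ i :: (q ++ r)).length := by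
      rw [h1, hat]; omega
    exact Multiset.toFinset_card_eq_card_iff_nodup.mp h3
  rcases normal n a hr i p q r he hn with hA | hB
  · exfalso
    obtain ⟨u, v, k, hk, hw, hl, -, -⟩ := hA
    have hr' : Red n (u ++ [i, k, i] ++ v) := by
      unfold Red
      rw [hw, ← hr, ← hl]; simp; omega
    have hc : (SF n (u ++ [i, k, i] ++ v)).card = (SF n a).card := by
      rw [← SF_card hr, ← SF_card hr', hw]
    have h1 := SF_append (n := n) (u ++ [i, k, i]) v
    have h2 := SF_append (n := n) u [i, k, i]
    have h3 := SF_iki n i k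
    have hb : (SF n (u ++ [i, k, i] ++ v)).card ≤ 2 ^ u.length * 6 * 2 ^ v.length :=
      h1.trans (Nat.mul_le_mul (h2.trans (Nat.mul_le_mul (SF_le u) h3)) (SF_le v))
    have hp : 2 ^ u.length * 6 * 2 ^ v.length = 12 * 2 ^ (a.length - 4) := by
      have : u.length + v.length = (a.length - 4) + 1 := by omega
      calc 2 ^ u.length * 6 * 2 ^ v.length = 6 * 2 ^ (u.length + v.length) := by ring
        _ = _ := by rw [this]; ring
    rw [hc, hcard, hp] at hb
    have := Nat.pos_of_ne_zero (pow_ne_zero (a.length - 4) (two_ne_zero (α := ℕ)))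
    omega
  · exact ⟨_, hB⟩


/-- `w` contains 3412 exactly once and avoids 321 iff the Bruhat
interval `[e, w]` is isomorphic as a poset to `[e, 3412] × B_{ℓ(w) - 4}`, where
`[e, 3412]` is the Bruhat interval below `3412` in `S₄` and `B_k` is the Boolean lattice
of rank `k`. -/
theorem stmt10 (n : ℕ) (w : Equiv.Perm (Fin n)) :
    (ContainsPatternOnce w pattern3412 ∧ AvoidsPattern w pattern321) ↔
      Nonempty
        ((fun x y : {v : Equiv.Perm (Fin n) // bruhatLE n v w} => bruhatLE n x.1 y.1) ≃r
          (fun p q : {v : Equiv.Perm (Fin 4) // bruhatLE 4 v pattern3412} ×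
              Finset (Fin (permLen n w - 4)) =>
            bruhatLE 4 p.1.1 q.1.1 ∧ p.2 ⊆ q.2)) := by
  constructor
  · rintro ⟨h1, h2⟩
    obtain ⟨m, h⟩ := forwardB h1 h2
    exact typeB_iso h
  · intro h
    obtain ⟨m, h'⟩ := backwardB h
    exact typeB_pattern h'
end

section
/- Let u, v, w ∈ S_n with v ≤ u ≤ w in Bruhat order and let r be such that s_r ∉ supp(w). Then T̄(u,[v, s_r w]) = T̄(u,[v,w]) ∪ {(u^{-1}(r), u^{-1}(r+1))} and T̄(u,[v, w s_r]) = T̄(u,[v,w]) ∪ {(r, r+1)}. -/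
namespace BR

def P (n : ℕ) (a : List ℕ) : Equiv.Perm (Fin n) := (a.map (simpleT n)).prod

def Red (n : ℕ) (a : List ℕ) : Prop := ∀ b, P n b = P n a → a.length ≤ b.length

def Step {n : ℕ} (x y : Equiv.Perm (Fin n)) : Prop :=
  ∃ a b : Fin n, a < b ∧ x a < x b ∧ y = x * Equiv.swap a b

def Ch {n : ℕ} : Equiv.Perm (Fin n) → Equiv.Perm (Fin n) → Prop := Relation.ReflTransGen Step

variable {n : ℕ}

theorem P_nil : P n [] = 1 := rfl
theorem P_cons (i : ℕ) (a : List ℕ) : P n (i :: a) = simpleT n i * P n a := by simp [P]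
theorem P_snoc (i : ℕ) (a : List ℕ) : P n (a ++ [i]) = P n a * simpleT n i := by simp [P]

theorem permLen_le (a : List ℕ) : permLen n (P n a) ≤ a.length :=
  Nat.sInf_le ⟨a, rfl, rfl⟩

theorem red_iff (a : List ℕ) (w : Equiv.Perm (Fin n)) :
    IsReducedWord n a w ↔ P n a = w ∧ Red n a := by
  constructor
  · rintro ⟨h1, h2⟩
    refine ⟨h1, fun b hb => ?_⟩
    have := permLen_le (n := n) b
    rw [hb, show P n a = w from h1] at this
    omega
  · rintro ⟨h1, h2⟩
    refine ⟨h1, ?_⟩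
    subst h1
    apply le_antisymm _ (permLen_le a)
    apply le_csInf
    · exact ⟨_, a, rfl, rfl⟩
    · rintro l ⟨b, rfl, hb⟩
      exact h2 b hb

theorem Red.len {a : List ℕ} (h : Red n a) : permLen n (P n a) = a.length :=
  (((red_iff a _).2 ⟨rfl, h⟩).2).symm

theorem simple_sq (i : ℕ) : simpleT n i * simpleT n i = 1 := by
  unfold simpleT
  split_ifs <;> simp

theorem simple_key (i : ℕ) (x y : Fin n) (h : x < y) (h2 : ¬ simpleT n i x < simpleT n i y) :
    simpleT n i = Equiv.swap x y := by
  unfold simpleT at h2 ⊢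
  split_ifs at h2 ⊢ with hi
  · have : x = ⟨i - 1, by omega⟩ ∧ y = ⟨i, hi.2⟩ := by
      simp only [Equiv.swap_apply_def, Fin.ext_iff, Fin.lt_def] at *
      split_ifs at h2 <;> simp at h2 <;> omega
    rw [this.1, this.2]
  · exact absurd h h2

theorem Step.symm' (x : Equiv.Perm (Fin n)) {a b : Fin n} (h : a < b) (h2 : ¬ x a < x b) :
    Step (x * Equiv.swap a b) x := by
  refine ⟨a, b, h, ?_, by simp [mul_assoc]⟩
  have : x a ≠ x b := fun e => h.ne (x.injective e)
  simp
  exact lt_of_le_of_ne (not_lt.1 h2) this.symm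

theorem exchange (c : List ℕ) : ∀ x : Equiv.Perm (Fin n), Step x (P n c) →
    ∃ d, d.Sublist c ∧ d.length + 1 = c.length ∧ P n d = x := by
  induction c with
  | nil =>
    rintro x ⟨a, b, hab, hx, h⟩
    rw [P_nil] at h
    have : x = Equiv.swap a b := by
      rw [← mul_one (Equiv.swap a b), h]
      have := congrArg (· * Equiv.swap a b) h
      simp [mul_assoc] at this
      rw [← this]; simp
    subst this
    simp at hx
    exact absurd hx (lt_asymm hab)
  | cons i c ih =>
    rintro x ⟨a, b, hab, hx, h⟩
    have hx' : x = P n (i :: c) * Equiv.swap a b := by rw [h]; simp [mul_assoc]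
    by_cases h1 : P n c a < P n c b
    · have h2 : ¬ simpleT n i (P n c a) < simpleT n i (P n c b) := by
        have e1 : simpleT n i (P n c a) = x b := by
          rw [← Equiv.Perm.mul_apply, ← P_cons, h]; simp
        have e2 : simpleT n i (P n c b) = x a := by
          rw [← Equiv.Perm.mul_apply, ← P_cons, h]; simp
        rw [e1, e2]; exact lt_asymm hx
      have h3 := simple_key i _ _ h1 h2
      refine ⟨c, List.sublist_cons_self _ _, rfl, ?_⟩
      rw [hx', P_cons, h3, Equiv.swap_mul_eq_mul_swap]
      simp [mul_assoc]
    · obtain ⟨d, hd, hl, hp⟩ := ih _ (Step.symm' _ hab h1)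
      refine ⟨i :: d, hd.cons_cons i, by simp [hl], ?_⟩
      rw [hx', P_cons, P_cons, hp, mul_assoc]

theorem step_len {x : Equiv.Perm (Fin n)} {c : List ℕ} (h : Step x (P n c)) :
    permLen n x < permLen n (P n c) := by
  have hne : ∃ b, b.length = permLen n (P n c) ∧ P n b = P n c :=
    Nat.sInf_mem (s := {l : ℕ | ∃ word : List ℕ, word.length = l ∧ (word.map (simpleT n)).prod = P n c})
      ⟨_, c, rfl, rfl⟩
  obtain ⟨b, hb, hp⟩ := hne
  rw [← hp] at h
  obtain ⟨d, -, hl, rfl⟩ := exchange b x h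
  have := permLen_le (n := n) d
  omega

theorem simple_left (i : ℕ) (z : Equiv.Perm (Fin n)) :
    Step z (simpleT n i * z) ∨ Step (simpleT n i * z) z ∨ simpleT n i = 1 := by
  by_cases hi : 1 ≤ i ∧ i < n
  · have hs : simpleT n i = Equiv.swap ⟨i - 1, by omega⟩ ⟨i, hi.2⟩ := by simp [simpleT, hi]
    rw [hs, Equiv.swap_mul_eq_mul_swap]
    have hlt : (⟨i - 1, by omega⟩ : Fin n) < ⟨i, hi.2⟩ := by simp [Fin.lt_def]; omega
    rcases lt_trichotomy (z⁻¹ ⟨i - 1, by omega⟩) (z⁻¹ ⟨i, hi.2⟩) with h | h | h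
    · left
      exact ⟨_, _, h, by simpa using hlt, rfl⟩
    · exact absurd (z⁻¹.injective h) hlt.ne
    · right; left
      rw [Equiv.swap_comm]
      exact Step.symm' _ h (by simpa using hlt.le)
  · right; right; simp [simpleT, hi]

theorem simple_right (i : ℕ) (z : Equiv.Perm (Fin n)) :
    Step z (z * simpleT n i) ∨ Step (z * simpleT n i) z ∨ simpleT n i = 1 := by
  by_cases hi : 1 ≤ i ∧ i < n
  · have hs : simpleT n i = Equiv.swap ⟨i - 1, by omega⟩ ⟨i, hi.2⟩ := by simp [simpleT, hi]
    rw [hs]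
    have hlt : (⟨i - 1, by omega⟩ : Fin n) < ⟨i, hi.2⟩ := by simp [Fin.lt_def]; omega
    by_cases h : z ⟨i - 1, by omega⟩ < z ⟨i, hi.2⟩
    · left
      exact ⟨_, _, hlt, h, rfl⟩
    · right; left
      exact Step.symm' _ hlt h
  · right; right; simp [simpleT, hi]

theorem Red.tail {i : ℕ} {c : List ℕ} (h : Red n (i :: c)) : Red n c := by
  intro b hb
  have := h (i :: b) (by rw [P_cons, P_cons, hb])
  simpa using this

theorem Red.step {i : ℕ} {c : List ℕ} (h : Red n (i :: c)) : Step (P n c) (P n (i :: c)) := by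
  rcases simple_left i (P n c) with h1 | h1 | h1
  · rwa [P_cons]
  · obtain ⟨d, _, hl, hp⟩ := exchange _ _ h1
    have := h d (by rw [hp, P_cons])
    simp at this; omega
  · have := h c (by rw [P_cons, h1, one_mul])
    simp at this

theorem deletion (k : ℕ) : ∀ c : List ℕ, c.length = k →
    ∃ d, d.Sublist c ∧ Red n d ∧ P n d = P n c := by
  induction k using Nat.strong_induction_on with
  | _ k ih =>
  intro c hc
  cases c with
  | nil => exact ⟨[], by simp, fun b _ => by simp, rfl⟩
  | cons i c =>
    simp only [List.length_cons] at hc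
    obtain ⟨d, hd, hr, hp⟩ := ih c.length (by omega) c rfl
    have hdl := hd.length_le
    have short : ∀ e : List ℕ, e.Sublist d → P n e = P n (i :: c) →
        ∃ f, f.Sublist (i :: c) ∧ Red n f ∧ P n f = P n (i :: c) := by
      intro e he hpe
      have := he.length_le
      obtain ⟨f, hf, hfr, hfp⟩ := ih e.length (by omega) e rfl
      exact ⟨f, (hf.trans (he.trans hd)).cons i, hfr, hfp.trans hpe⟩
    rcases simple_left i (P n d) with h1 | h1 | h1
    · refine ⟨i :: d, hd.cons_cons i, ?_, by rw [P_cons, P_cons, hp]⟩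
      intro b hb
      rw [← P_cons, ← hb] at h1
      have h2 := step_len h1
      have := permLen_le (n := n) b
      rw [hr.len] at h2
      simp; omega
    · obtain ⟨e, he, hl, hep⟩ := exchange _ _ h1
      exact short e he (by rw [hep, P_cons, hp])
    · exact short d (List.Sublist.refl _) (by rw [P_cons, h1, one_mul, hp])

theorem ch_sub {x y : Equiv.Perm (Fin n)} (h : Ch x y) : ∀ c, P n c = y →
    ∃ d, d.Sublist c ∧ Red n d ∧ P n d = x := by
  suffices H : ∀ c, P n c = y → ∃ d, d.Sublist c ∧ P n d = x by
    intro c hc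
    obtain ⟨d, hd, hp⟩ := H c hc
    obtain ⟨e, he, hr, hp'⟩ := deletion (n := n) _ d rfl
    exact ⟨e, he.trans hd, hr, hp'.trans hp⟩
  induction h using Relation.ReflTransGen.head_induction_on with
  | refl => exact fun c hc => ⟨c, List.Sublist.refl _, hc⟩
  | head h1 _ ih =>
    intro c hc
    obtain ⟨d, hd, hp⟩ := ih c hc
    rw [← hp] at h1
    obtain ⟨e, he, _, hpe⟩ := exchange d _ h1
    exact ⟨e, he.trans hd, hpe⟩

theorem ch_simple (i : ℕ) {x y : Equiv.Perm (Fin n)} (h : Ch x y) :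
    Ch (simpleT n i * x) (simpleT n i * y) ∨ Ch (simpleT n i * x) y := by
  induction h using Relation.ReflTransGen.head_induction_on with
  | refl => exact Or.inl .refl
  | @head x z h1 h2 ih =>
    obtain ⟨a, b, hab, hx, rfl⟩ := h1
    by_cases h3 : simpleT n i (x a) < simpleT n i (x b)
    · have : Step (simpleT n i * x) (simpleT n i * (x * Equiv.swap a b)) :=
        ⟨a, b, hab, h3, by rw [mul_assoc]⟩
      exact ih.imp (fun h => .head this h) (fun h => .head this h)
    · have h4 := simple_key i _ _ hx h3
      right
      have : simpleT n i * x = x * Equiv.swap a b := by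
        rw [h4, Equiv.swap_mul_eq_mul_swap]; simp
      rw [this]; exact h2

theorem sub_ch (c : List ℕ) : Red n c → ∀ d : List ℕ, d.Sublist c → Ch (P n d) (P n c) := by
  induction c with
  | nil => intro _ d hd; rw [List.sublist_nil.1 hd]; exact .refl
  | cons i c ih =>
    intro hr d hd
    rcases List.sublist_cons_iff.1 hd with h | ⟨d', rfl, h⟩
    · exact (ih hr.tail d h).tail hr.step
    · have := ch_simple i (ih hr.tail d' h)
      rw [← P_cons, ← P_cons] at this
      exact this.elim id (fun h => h.tail hr.step)

theorem le_ch {x y : Equiv.Perm (Fin n)} (h : bruhatLE n x y) : Ch x y := by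
  obtain ⟨a, b, ha, hb, hs⟩ := h
  rw [red_iff] at ha hb
  rw [← ha.1, ← hb.1]
  exact sub_ch b hb.2 a hs

theorem le_of_sub {a b : List ℕ} (ha : Red n a) (hb : Red n b) (h : a.Sublist b) :
    bruhatLE n (P n a) (P n b) :=
  ⟨a, b, (red_iff _ _).2 ⟨rfl, ha⟩, (red_iff _ _).2 ⟨rfl, hb⟩, h⟩

theorem simple_ne_one {r : ℕ} (hr : 1 ≤ r) (hrn : r < n) : simpleT n r ≠ 1 := by
  intro h
  have := congrArg (fun f : Equiv.Perm (Fin n) => ((f ⟨r, hrn⟩ : Fin n) : ℕ)) h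
  simp [simpleT, hr, hrn] at this
  omega

theorem simple_inj {r i : ℕ} (hr : 1 ≤ r) (hrn : r < n) (h : simpleT n i = simpleT n r) :
    i = r := by
  by_cases hi : 1 ≤ i ∧ i < n
  · have h1 := congrArg (fun f : Equiv.Perm (Fin n) => ((f ⟨r, hrn⟩ : Fin n) : ℕ)) h
    simp [simpleT, hr, hrn, hi, Equiv.swap_apply_def, Fin.ext_iff] at h1
    split_ifs at h1 <;> simp at h1 <;> omega
  · exact absurd (h.symm.trans (by simp [simpleT, hi])) (simple_ne_one hr hrn)

theorem supp_le {r : ℕ} (hr : 1 ≤ r) (hrn : r < n) {u w : Equiv.Perm (Fin n)}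
    (h : bruhatLE n u w) (hw : r ∉ permSupp n w) : r ∉ permSupp n u := by
  obtain ⟨a, b, ha, hb, hs⟩ := h
  have hrb : r ∉ a := fun h => hw ⟨b, hb, hs.subset h⟩
  rintro ⟨a', ha', hra⟩
  rw [red_iff] at ha ha'
  have h1 := sub_ch a' ha'.2 [r] (List.singleton_sublist.2 hra)
  rw [ha'.1] at h1
  obtain ⟨d, hd, hdr, hp⟩ := ch_sub h1 a ha.1
  have hl := hdr [r] hp.symm
  have hp2 : P n [r] = simpleT n r := by simp [P]
  rw [hp2] at hp
  match d, hl with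
  | [], _ => exact simple_ne_one hr hrn hp.symm
  | [i], _ =>
    have : i = r := simple_inj hr hrn (by rw [← hp]; simp [P])
    subst this
    exact hrb (hd.subset (by simp))
  | _ :: _ :: _, h => simp at h

theorem red_left {r : ℕ} (hr : 1 ≤ r) (hrn : r < n) {c : List ℕ} (hc : Red n c)
    (hw : r ∉ permSupp n (P n c)) : Red n (r :: c) := by
  rcases simple_left r (P n c) with h1 | h1 | h1
  · intro b hb
    rw [← P_cons, ← hb] at h1
    have h2 := step_len h1
    have := permLen_le (n := n) b
    rw [hc.len] at h2
    simp; omega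
  · obtain ⟨d, _, hl, hp⟩ := exchange _ _ h1
    have hpe : P n (r :: d) = P n c := by rw [P_cons, hp, ← mul_assoc, simple_sq, one_mul]
    refine absurd ⟨r :: d, ⟨hpe, ?_⟩, by simp⟩ hw
    rw [hc.len]; simpa using hl
  · exact absurd h1 (simple_ne_one hr hrn)

theorem red_right {r : ℕ} (hr : 1 ≤ r) (hrn : r < n) {c : List ℕ} (hc : Red n c)
    (hw : r ∉ permSupp n (P n c)) : Red n (c ++ [r]) := by
  rcases simple_right r (P n c) with h1 | h1 | h1
  · intro b hb
    rw [← P_snoc, ← hb] at h1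
    have h2 := step_len h1
    have := permLen_le (n := n) b
    rw [hc.len] at h2
    simp; omega
  · obtain ⟨d, _, hl, hp⟩ := exchange _ _ h1
    have hpe : P n (d ++ [r]) = P n c := by rw [P_snoc, hp, mul_assoc, simple_sq, mul_one]
    refine absurd ⟨d ++ [r], ⟨hpe, ?_⟩, by simp⟩ hw
    rw [hc.len]; simpa using hl
  · exact absurd h1 (simple_ne_one hr hrn)

theorem red_init {c : List ℕ} {r : ℕ} (h : Red n (c ++ [r])) : Red n c := by
  intro b hb
  have := h (b ++ [r]) (by rw [P_snoc, P_snoc, hb])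
  simpa using this

theorem core_left {r : ℕ} (hr : 1 ≤ r) (hrn : r < n) {u w : Equiv.Perm (Fin n)}
    (huw : bruhatLE n u w) (hw : r ∉ permSupp n w) (y : Equiv.Perm (Fin n)) :
    (bruhatLT n u y ∧ bruhatLE n y (simpleT n r * w) ∧ permLen n y = permLen n u + 1) ↔
    ((bruhatLT n u y ∧ bruhatLE n y w ∧ permLen n y = permLen n u + 1) ∨
      y = simpleT n r * u) := by
  have hu := supp_le hr hrn huw hw
  obtain ⟨a, c, ha, hc, hs⟩ := huw
  rw [red_iff] at ha hc
  obtain ⟨rfl, ha⟩ := ha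
  obtain ⟨rfl, hc⟩ := hc
  have hrc := red_left hr hrn hc hw
  have hra := red_left hr hrn ha hu
  rw [← P_cons, ← P_cons]
  constructor
  · rintro ⟨h1, h2, h3⟩
    obtain ⟨d, hd, hdr, rfl⟩ := ch_sub (le_ch h2) _ rfl
    rcases List.sublist_cons_iff.1 hd with h | ⟨d', rfl, h⟩
    · exact Or.inl ⟨h1, le_of_sub hdr hc h, h3⟩
    · right
      obtain ⟨e, he, her, hep⟩ := ch_sub (le_ch h1.1) _ rfl
      have hre : r ∉ e := fun h => hu ⟨e, (red_iff _ _).2 ⟨hep, her⟩, h⟩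
      rw [← hep, her.len, hdr.len] at h3
      rcases List.sublist_cons_iff.1 he with h' | ⟨e', rfl, h'⟩
      · have := h'.eq_of_length (by simpa using h3.symm)
        subst this
        rw [P_cons, P_cons, hep]
      · simp at hre
  · rintro (⟨h1, h2, h3⟩ | rfl)
    · refine ⟨h1, ?_, h3⟩
      obtain ⟨d, hd, hdr, rfl⟩ := ch_sub (le_ch h2) _ rfl
      exact le_of_sub hdr hrc (hd.cons r)
    · have hl : permLen n (P n (r :: a)) = permLen n (P n a) + 1 := by
        rw [hra.len, ha.len]; simp
      refine ⟨⟨le_of_sub ha hra (List.sublist_cons_self _ _), ?_⟩,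
        le_of_sub hra hrc (hs.cons_cons r), hl⟩
      intro h
      rw [← h] at hl
      omega

theorem sub_snoc {d c : List ℕ} {r : ℕ} (h : d.Sublist (c ++ [r])) :
    d.Sublist c ∨ ∃ d', d = d' ++ [r] ∧ d'.Sublist c := by
  obtain ⟨d1, d2, rfl, h1, h2⟩ := List.sublist_append_iff.1 h
  rcases List.sublist_singleton.1 h2 with rfl | rfl
  · left; simpa using h1
  · exact Or.inr ⟨d1, rfl, h1⟩

theorem core_right {r : ℕ} (hr : 1 ≤ r) (hrn : r < n) {u w : Equiv.Perm (Fin n)}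
    (huw : bruhatLE n u w) (hw : r ∉ permSupp n w) (y : Equiv.Perm (Fin n)) :
    (bruhatLT n u y ∧ bruhatLE n y (w * simpleT n r) ∧ permLen n y = permLen n u + 1) ↔
    ((bruhatLT n u y ∧ bruhatLE n y w ∧ permLen n y = permLen n u + 1) ∨
      y = u * simpleT n r) := by
  have hu := supp_le hr hrn huw hw
  obtain ⟨a, c, ha, hc, hs⟩ := huw
  rw [red_iff] at ha hc
  obtain ⟨rfl, ha⟩ := ha
  obtain ⟨rfl, hc⟩ := hc
  have hrc := red_right hr hrn hc hw
  have hra := red_right hr hrn ha hu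
  rw [← P_snoc, ← P_snoc]
  constructor
  · rintro ⟨h1, h2, h3⟩
    obtain ⟨d, hd, hdr, rfl⟩ := ch_sub (le_ch h2) _ rfl
    rcases sub_snoc hd with h | ⟨d', rfl, h⟩
    · exact Or.inl ⟨h1, le_of_sub hdr hc h, h3⟩
    · right
      obtain ⟨e, he, her, hep⟩ := ch_sub (le_ch h1.1) _ rfl
      have hre : r ∉ e := fun h => hu ⟨e, (red_iff _ _).2 ⟨hep, her⟩, h⟩
      rw [← hep, her.len, hdr.len] at h3
      rcases sub_snoc he with h' | ⟨e', rfl, h'⟩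
      · have := h'.eq_of_length (by simpa using h3.symm)
        subst this
        rw [P_snoc, P_snoc, hep]
      · simp at hre
  · rintro (⟨h1, h2, h3⟩ | rfl)
    · refine ⟨h1, ?_, h3⟩
      obtain ⟨d, hd, hdr, rfl⟩ := ch_sub (le_ch h2) _ rfl
      exact le_of_sub hdr hrc (hd.trans (List.sublist_append_left _ _))
    · have hl : permLen n (P n (a ++ [r])) = permLen n (P n a) + 1 := by
        rw [hra.len, ha.len]; simp
      refine ⟨⟨le_of_sub ha hra (List.sublist_append_left _ _), ?_⟩,
        le_of_sub hra hrc (hs.append (List.Sublist.refl _)), hl⟩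
      intro h
      rw [← h] at hl
      omega

/-- descent direction of `u` at values `r, r+1` -/
theorem lt_left {r : ℕ} (hr : 1 ≤ r) (hrn : r < n) (h0 : r - 1 < n) {u w : Equiv.Perm (Fin n)}
    (huw : bruhatLE n u w) (hw : r ∉ permSupp n w) :
    u⁻¹ ⟨r - 1, h0⟩ < u⁻¹ ⟨r, hrn⟩ := by
  have hu := supp_le hr hrn huw hw
  obtain ⟨a, c, ha, hc, hs⟩ := huw
  rw [red_iff] at ha
  obtain ⟨rfl, ha⟩ := ha
  have hra := red_left hr hrn ha hu
  have hs : simpleT n r = Equiv.swap ⟨r - 1, by omega⟩ ⟨r, hrn⟩ := by simp [simpleT, hr, hrn]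
  have hlt : (⟨r - 1, by omega⟩ : Fin n) < ⟨r, hrn⟩ := by simp [Fin.lt_def]; omega
  by_contra hcon
  have hne : (P n a)⁻¹ ⟨r, hrn⟩ ≠ (P n a)⁻¹ ⟨r - 1, by omega⟩ :=
    fun h => hlt.ne ((P n a)⁻¹.injective h).symm
  have h := lt_of_le_of_ne (not_lt.1 hcon) hne
  have hst := Step.symm' (P n a) h (by simpa using hlt.le)
  have hl := step_len hst
  rw [Equiv.swap_comm, ← Equiv.swap_mul_eq_mul_swap, ← hs, ← P_cons, hra.len, ha.len] at hl
  simp at hl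

theorem transp_eq {i j : ℕ} (h1 : 1 ≤ i) (h2 : i < j) (h3 : j ≤ n) {a b : Fin n} (hab : a < b) :
    transpPerm n i j = Equiv.swap a b ↔ (i, j) = ((a : ℕ) + 1, (b : ℕ) + 1) := by
  simp only [transpPerm, h1, h2, h3, and_self, dite_true]
  constructor
  · intro h
    have e1 := congrArg (fun f : Equiv.Perm (Fin n) => ((f a : Fin n) : ℕ)) h
    have e2 := congrArg (fun f : Equiv.Perm (Fin n) => ((f b : Fin n) : ℕ)) h
    simp only [Equiv.swap_apply_def, Fin.ext_iff, Fin.lt_def, Prod.mk.injEq] at *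
    split_ifs at e1 e2 <;> (try simp at e1 e2) <;> omega
  · intro h
    simp only [Prod.mk.injEq] at h
    congr 1 <;> simp [Fin.ext_iff] <;> omega

end BR

/-- For `v ≤ u ≤ w` and `s_r ∉ supp(w)`:
`T̄(u,[v, s_r w]) = T̄(u,[v,w]) ∪ {(u⁻¹(r), u⁻¹(r+1))}` and
`T̄(u,[v, w s_r]) = T̄(u,[v,w]) ∪ {(r, r+1)}`. -/
theorem stmt13 (n r : ℕ) (hr : 1 ≤ r) (hrn : r < n) (u v w : Equiv.Perm (Fin n))
    (hvu : bruhatLE n v u) (huw : bruhatLE n u w) (hw : r ∉ permSupp n w) :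
    upperT n u v (simpleT n r * w) =
      upperT n u v w ∪
        {(((u⁻¹ ⟨r - 1, by omega⟩ : Fin n) : ℕ) + 1,
          ((u⁻¹ ⟨r, hrn⟩ : Fin n) : ℕ) + 1)} ∧
    upperT n u v (w * simpleT n r) = upperT n u v w ∪ {(r, r + 1)} := by
  have hs : simpleT n r = Equiv.swap ⟨r - 1, by omega⟩ ⟨r, hrn⟩ := by simp [simpleT, hr, hrn]
  constructor
  · ext ⟨i, j⟩
    have hlt := BR.lt_left hr hrn (by omega) huw hw
    have key := BR.core_left hr hrn huw hw (u * transpPerm n i j)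
    rw [hs, Equiv.swap_mul_eq_mul_swap u, mul_right_inj] at key
    simp only [upperT, Set.mem_union, Set.mem_setOf_eq, Set.mem_singleton_iff]
    constructor
    · rintro ⟨h1, h2, h3, h⟩
      rw [hs] at h
      exact (key.1 h).imp (fun h => ⟨h1, h2, h3, h⟩) (BR.transp_eq h1 h2 h3 hlt).1
    · intro h
      have hb : 1 ≤ i ∧ i < j ∧ j ≤ n := by
        rcases h with h | h
        · exact ⟨h.1, h.2.1, h.2.2.1⟩
        · simp only [Prod.mk.injEq] at h
          rw [Fin.lt_def] at hlt
          omega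
      refine ⟨hb.1, hb.2.1, hb.2.2, ?_⟩
      rw [hs]
      exact key.2 (h.imp (fun h => h.2.2.2) (BR.transp_eq hb.1 hb.2.1 hb.2.2 hlt).2)
  · ext ⟨i, j⟩
    have hlt : (⟨r - 1, by omega⟩ : Fin n) < ⟨r, hrn⟩ := by simp [Fin.lt_def]; omega
    have key := BR.core_right hr hrn huw hw (u * transpPerm n i j)
    rw [hs, mul_right_inj] at key
    have hpair : ((r, r + 1) : ℕ × ℕ) = (r - 1 + 1, r + 1) := by
      rw [Nat.sub_add_cancel hr]
    simp only [upperT, Set.mem_union, Set.mem_setOf_eq, Set.mem_singleton_iff]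
    rw [hpair, hs]
    constructor
    · rintro ⟨h1, h2, h3, h⟩
      exact (key.1 h).imp (fun h => ⟨h1, h2, h3, h⟩) (BR.transp_eq h1 h2 h3 hlt).1
    · intro h
      have hb : 1 ≤ i ∧ i < j ∧ j ≤ n := by
        rcases h with h | h
        · exact ⟨h.1, h.2.1, h.2.2.1⟩
        · simp only [Prod.mk.injEq] at h
          omega
      refine ⟨hb.1, hb.2.1, hb.2.2, ?_⟩
      exact key.2 (h.imp (fun h => h.2.2.2) (BR.transp_eq hb.1 hb.2.1 hb.2.2 hlt).2)
end
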